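/- Let n ≥ 2, β ≥ 0, C₀ > 1 and let χ be a cutoff. Assume α satisfies one of: (i) (n−3)/2 < β < (n−1)/2 and α < 2β − (n−3)/2; or (ii) β ≥ (n−1)/2 and α < β + 1. Then there exists a constant C > 0 such that for every θ ∈ S^{n−1} and every Schwartz function q on ℝⁿ, the function F(η) := χ(η) · (B_{θ,2}(q)(η) + B_{−θ,2}(q)(η)) — the Fourier transform of the cut-off double dispersion operator Q̃_{θ,2}(q) of fixed angle scattering — satisfies ‖F‖_{L²_α} ≤ C ‖q‖²_{W^{β,2}_2}, where B_{θ,2}(q)(η) := i π S_{θ,1}(q)(η) + P_θ(q)(η) for η ∈ H_θ and := 0 for η ∉ H_θ (and similarly for −θ); in particular all principal value limits defining P_{±θ}(q) on H_{±θ} exist. -/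

import Mathlib

open MeasureTheory Real Filter Set Metric
open scoped FourierTransform RealInnerProductSpace SchwartzMap ENNReal

noncomputable section

abbrev En (n : ℕ) := EuclideanSpace ℝ (Fin n)

/-- Japanese bracket `⟨x⟩ = (1+|x|²)^{1/2}`. -/
def jap {n : ℕ} (x : En n) : ℝ := Real.sqrt (1 + ‖x‖ ^ 2)

/-- `k(η,θ) = -|η|²/(θ·η)`. -/
def kval {n : ℕ} (θ η : En n) : ℝ := -‖η‖ ^ 2 / ⟪θ, η⟫

/-- The Ewald sphere `Γ_r(-2kθ)`, of center `-kθ` and radius `rk`. -/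
def ewald {n : ℕ} (θ η : En n) (r : ℝ) : Set (En n) :=
  Metric.sphere (-(kval θ η • θ)) (r * kval θ η)

/-- The spherical operator `S_{θ,r}`. -/
def Sop {n : ℕ} (θ : En n) (r : ℝ) (q : En n → ℂ) (η : En n) : ℂ :=
  if ⟪η, θ⟫ < 0 then
    ((kval θ η * (r + 1))⁻¹ : ℝ) •
      ∫ ξ in ewald θ η r, 𝓕 q ξ * 𝓕 q (η - ξ) ∂μH[(n : ℝ) - 1]
  else 0

/-- The operator `K_r(g₁,g₂)`. -/
def Kop {n : ℕ} {G₁ G₂ : Type*} [NormedAddCommGroup G₁] [NormedAddCommGroup G₂]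
    (θ : En n) (r : ℝ) (g₁ : En n → G₁) (g₂ : En n → G₂) (η : En n) : ℝ :=
  if ⟪η, θ⟫ < 0 then
    (kval θ η)⁻¹ * ∫ ξ in ewald θ η r, ‖g₁ ξ‖ * ‖g₂ (η - ξ)‖ ∂μH[(n : ℝ) - 1]
  else 0

/-- Weighted norm `‖F‖_{L²_α}`. -/
def L2w {n : ℕ} {G : Type*} [NormedAddCommGroup G] (α : ℝ) (F : En n → G) : ℝ :=
  (∫ η, jap η ^ (2 * α) * ‖F η‖ ^ 2) ^ (1/2 : ℝ)

/-- Weighted Sobolev norm `‖q‖_{W^{β,2}_δ} = ‖⟨·⟩^δ 𝓕⁻¹(⟨·⟩^β 𝓕q)‖_{L²}`. -/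
def sobNorm {n : ℕ} (β δ : ℝ) (q : En n → ℂ) : ℝ :=
  (∫ x, jap x ^ (2 * δ) * ‖𝓕⁻ (fun ξ => (jap ξ ^ β : ℝ) • 𝓕 q ξ) x‖ ^ 2) ^ (1/2 : ℝ)

/-- A smooth radial cutoff vanishing for `|ξ| < C₀` and equal to `1` for `|ξ| > 2C₀`. -/
structure IsCutoff {n : ℕ} (C₀ : ℝ) (χ : En n → ℝ) : Prop where
  smooth : ContDiff ℝ (⊤ : ℕ∞) χ
  mem_Icc : ∀ ξ, χ ξ ∈ Set.Icc (0 : ℝ) 1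
  eq_one : ∀ ξ : En n, 2 * C₀ < ‖ξ‖ → χ ξ = 1
  eq_zero : ∀ ξ : En n, ‖ξ‖ < C₀ → χ ξ = 0

open Measure in
/-- Eilenberg's inequality for the norm function. -/
theorem eilenberg_norm {n : ℕ} {d : ℝ} (hd : 0 < d) (A : Set (En n)) :
    ∫⁻ t : ℝ, μH[d] (A ∩ {x | ‖x‖ = t}) ≤ μH[d + 1] A := by
  classical
  by_cases htop : μH[d + 1] A = ⊤
  · rw [htop]; exact le_top
  -- choose covers
  have hcov : ∀ j : ℕ, ∃ t : ℕ → Set (En n), A ⊆ ⋃ i, t i ∧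
      (∀ i, ediam (t i) ≤ ((j : ℝ≥0∞) + 1)⁻¹) ∧
      ∑' i, ediam (t i) ^ (d + 1) ≤ μH[d + 1] A + ((j : ℝ≥0∞) + 1)⁻¹ := by
    intro j
    have hpos : (0 : ℝ≥0∞) < ((j : ℝ≥0∞) + 1)⁻¹ := by
      apply ENNReal.inv_pos.2
      exact_mod_cast ENNReal.natCast_ne_top (j + 1)
    have h1 : (⨅ (t : ℕ → Set (En n)) (_ : A ⊆ ⋃ i, t i)
        (_ : ∀ i, ediam (t i) ≤ ((j : ℝ≥0∞) + 1)⁻¹),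
          ∑' i, ⨆ _ : (t i).Nonempty, ediam (t i) ^ (d + 1)) ≤ μH[d + 1] A := by
      rw [hausdorffMeasure_apply (d + 1) A]
      exact le_iSup₂_of_le _ hpos le_rfl
    have h2 := lt_of_le_of_lt h1 (ENNReal.lt_add_right htop hpos.ne')
    simp only [iInf_lt_iff] at h2
    obtain ⟨t, ht1, ht2, ht3⟩ := h2
    refine ⟨t, ht1, ht2, le_trans (ENNReal.tsum_le_tsum fun i => ?_) ht3.le⟩
    rcases (t i).eq_empty_or_nonempty with h | h
    · rw [h]; simp [ENNReal.zero_rpow_of_pos (show 0 < d + 1 by linarith)]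
    · simp [h]
  choose t ht1 ht2 ht3 using hcov
  let I : ℕ → ℕ → Set ℝ := fun j i => closure ((fun x : En n => ‖x‖) '' (t j i))
  have hI : ∀ j i, volume (I j i) ≤ ediam (t j i) := by
    intro j i
    refine (Real.volume_le_diam _).trans ?_
    simp only [I, ediam_closure]
    have := (lipschitzWith_one_norm (E := En n)).ediam_image_le (t j i)
    simpa using this
  let F : ℕ → ℝ → ℝ≥0∞ := fun j s => ∑' i, (I j i).indicator (fun _ => ediam (t j i) ^ d) s
  have hFm : ∀ j, Measurable (F j) := fun j =>
    Measurable.tsum fun i => measurable_const.indicator isClosed_closure.measurableSet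
  have hFi : ∀ j, ∫⁻ s, F j s ≤ μH[d + 1] A + ((j : ℝ≥0∞) + 1)⁻¹ := by
    intro j
    rw [lintegral_tsum fun i =>
      (measurable_const.indicator isClosed_closure.measurableSet).aemeasurable]
    refine le_trans (ENNReal.tsum_le_tsum fun i => ?_) (ht3 j)
    rw [lintegral_indicator isClosed_closure.measurableSet, setLIntegral_const]
    rw [ENNReal.rpow_add_of_nonneg _ _ hd.le zero_le_one, ENNReal.rpow_one]
    gcongr
    exact hI j i
  have hlim : Tendsto (fun j : ℕ => ((j : ℝ≥0∞) + 1)⁻¹) atTop (nhds 0) := by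
    have := (tendsto_add_atTop_iff_nat 1).2 ENNReal.tendsto_inv_nat_nhds_zero
    simpa using this
  have hpt : ∀ s : ℝ, μH[d] (A ∩ {x | ‖x‖ = s}) ≤ liminf (fun j => F j s) atTop := by
    intro s
    refine (hausdorffMeasure_le_liminf_tsum d _ (fun j : ℕ => ((j : ℝ≥0∞) + 1)⁻¹) hlim
      (fun j i => t j i ∩ {x | ‖x‖ = s}) (Eventually.of_forall fun j i => ?_)
      (Eventually.of_forall fun j => ?_)).trans ?_
    · exact (ediam_mono inter_subset_left).trans (ht2 j i)
    · rw [← iUnion_inter]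
      exact inter_subset_inter_left _ (ht1 j)
    · refine liminf_le_liminf (Eventually.of_forall fun j => ?_)
      refine ENNReal.tsum_le_tsum fun i => ?_
      rcases (t j i ∩ {x | ‖x‖ = s}).eq_empty_or_nonempty with h | ⟨x, hx1, hx2⟩
      · rw [h]; simp [ENNReal.zero_rpow_of_pos hd]
      · have hs : s ∈ I j i := subset_closure ⟨x, hx1, hx2⟩
        rw [indicator_of_mem hs]
        exact ENNReal.rpow_le_rpow (ediam_mono inter_subset_left) hd.le
  calc ∫⁻ s : ℝ, μH[d] (A ∩ {x | ‖x‖ = s}) ≤ ∫⁻ s, liminf (fun j => F j s) atTop :=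
        lintegral_mono hpt
    _ ≤ liminf (fun j => ∫⁻ s, F j s) atTop := lintegral_liminf_le hFm
    _ ≤ liminf (fun j : ℕ => μH[d + 1] A + ((j : ℝ≥0∞) + 1)⁻¹) atTop :=
        liminf_le_liminf (Eventually.of_forall hFi)
    _ = μH[d + 1] A := by
        apply Tendsto.liminf_eq
        simpa using tendsto_const_nhds.add hlim

section
open scoped Pointwise
/-- Hausdorff measure on the unit sphere. -/
def snu (n : ℕ) : Measure (En n) := (μH[(n : ℝ) - 1]).restrict (sphere 0 1)

theorem snu_image {n : ℕ} (hn : 2 ≤ n) (c : En n) {R : ℝ} (hR : 0 < R) (T : Set (En n)) :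
    μH[(n : ℝ) - 1] ((fun ω : En n => c + R • ω) '' T)
      = ENNReal.ofReal (R ^ (n - 1)) * μH[(n : ℝ) - 1] T := by
  have h2 : (2 : ℝ) ≤ n := by exact_mod_cast hn
  have e : (fun ω : En n => c + R • ω) '' T = (IsometryEquiv.addLeft c) '' (R • T) := by
    rw [← image_smul, image_image]; rfl
  rw [e, IsometryEquiv.hausdorffMeasure_image,
    Measure.hausdorffMeasure_smul₀ (by linarith) hR.ne']
  have e2 : ((n : ℝ) - 1) = ((n - 1 : ℕ) : ℝ) := by
    rw [Nat.cast_sub (by omega)]; simp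
  rw [e2, NNReal.rpow_natCast, ENNReal.smul_def, smul_eq_mul]
  congr 1
  rw [ENNReal.ofReal_pow hR.le, ENNReal.coe_pow]
  congr 1
  have : ENNReal.ofReal ‖R‖ = (‖R‖₊ : ℝ≥0∞) := ofReal_norm R
  rw [← this, Real.norm_of_nonneg hR.le]

theorem sphere_inter_eq {n : ℕ} (c : En n) {R : ℝ} (hR : 0 < R) (A : Set (En n)) :
    A ∩ sphere c R = (fun ω : En n => c + R • ω) ''
      ((fun ω : En n => c + R • ω) ⁻¹' A ∩ sphere 0 1) := by
  ext x
  simp only [mem_inter_iff, mem_image, mem_preimage, mem_sphere, dist_zero_right]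
  constructor
  · rintro ⟨hA, hx⟩
    have e : c + R • (R⁻¹ • (x - c)) = x := by
      rw [smul_smul, mul_inv_cancel₀ hR.ne', one_smul]; abel
    refine ⟨R⁻¹ • (x - c), ⟨by rwa [e], ?_⟩, e⟩
    rw [norm_smul, ← dist_eq_norm, hx, norm_inv, Real.norm_of_nonneg hR.le,
      inv_mul_cancel₀ hR.ne']
  · rintro ⟨w, ⟨hA, hw⟩, rfl⟩
    refine ⟨hA, ?_⟩
    rw [dist_eq_norm, add_sub_cancel_left, norm_smul, hw, Real.norm_of_nonneg hR.le, mul_one]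

theorem restrict_sphere_eq {n : ℕ} (hn : 2 ≤ n) (c : En n) {R : ℝ} (hR : 0 < R) :
    (μH[(n : ℝ) - 1] : Measure (En n)).restrict (sphere c R)
      = ENNReal.ofReal (R ^ (n - 1)) • (snu n).map (fun ω : En n => c + R • ω) := by
  ext A hA
  have hm : Measurable (fun ω : En n => c + R • ω) := by fun_prop
  rw [Measure.restrict_apply hA, Measure.smul_apply, Measure.map_apply hm hA, snu,
    Measure.restrict_apply (hm hA), sphere_inter_eq c hR, snu_image hn c hR, smul_eq_mul]

theorem hausdorff_eq_smul_volume (n : ℕ) :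
    ∃ C : ℝ≥0∞, C ≠ ⊤ ∧ (μH[(n : ℝ)] : Measure (En n)) = C • volume := by
  have h := Measure.isAddLeftInvariant_eq_smul
    (μH[Module.finrank ℝ (En n)] : Measure (En n)) volume
  simp only [finrank_euclideanSpace, Fintype.card_fin] at h
  exact ⟨_, ENNReal.coe_ne_top, h⟩

theorem snu_finite {n : ℕ} (hn : 2 ≤ n) : IsFiniteMeasure (snu n) := by
  refine ⟨lt_top_iff_ne_top.2 fun htop => ?_⟩
  have h2 : (2 : ℝ) ≤ n := by exact_mod_cast hn
  have h := eilenberg_norm (n := n) (d := (n : ℝ) - 1) (by linarith) (ball 0 2)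
  rw [sub_add_cancel] at h
  obtain ⟨C, hC, hCe⟩ := hausdorff_eq_smul_volume n
  have hfin : μH[(n : ℝ)] (ball (0 : En n) 2) < ⊤ := by
    rw [hCe, Measure.smul_apply, smul_eq_mul]
    exact ENNReal.mul_lt_top hC.lt_top measure_ball_lt_top
  have htop' : μH[(n : ℝ) - 1] (sphere (0 : En n) 1) = ⊤ := by
    rw [snu, Measure.restrict_apply_univ] at htop; exact htop
  have h3 : ∫⁻ t in Ioo (1 : ℝ) 2, ⊤ ≤
      ∫⁻ t : ℝ, μH[(n : ℝ) - 1] (ball (0 : En n) 2 ∩ {x | ‖x‖ = t}) := by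
    refine le_trans (lintegral_mono_ae ?_) (setLIntegral_le_lintegral (Ioo (1 : ℝ) 2) _)
    filter_upwards [ae_restrict_mem measurableSet_Ioo] with t ht
    have ht0 : 0 < t := by linarith [ht.1]
    have e : ball (0 : En n) 2 ∩ {x | ‖x‖ = t} =
        (fun ω : En n => 0 + t • ω) '' (sphere 0 1) := by
      have := sphere_inter_eq (0 : En n) ht0 univ
      simp only [univ_inter, preimage_univ] at this
      rw [← this]
      ext x
      simp only [mem_inter_iff, mem_ball, dist_zero_right, mem_ofPred_eq, mem_sphere]
      constructor
      · exact fun h => h.2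
      · intro h; exact ⟨by rw [h]; exact ht.2, h⟩
    rw [e, snu_image hn 0 ht0, htop', ENNReal.mul_top]
    simp; positivity
  have h4 : ∫⁻ t in Ioo (1 : ℝ) 2, (⊤ : ℝ≥0∞) = ⊤ := by
    rw [setLIntegral_const]; simp
  rw [h4] at h3
  exact absurd (h3.trans h) (not_le.2 hfin)

/-- Integration in (Hausdorff) polar coordinates is dominated by Lebesgue integration. -/
theorem solid_bound {n : ℕ} (hn : 2 ≤ n) : ∃ C : ℝ≥0∞, C ≠ ⊤ ∧
    ∀ (F : En n → ℝ≥0∞), Measurable F → ∀ c : En n,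
      ∫⁻ ρ in Ioi (0 : ℝ), ENNReal.ofReal (ρ ^ (n - 1)) * ∫⁻ ω, F (c + ρ • ω) ∂(snu n)
        ≤ C * ∫⁻ ξ, F ξ := by
  obtain ⟨C, hC, hCe⟩ := hausdorff_eq_smul_volume n
  refine ⟨C, hC, ?_⟩
  have := snu_finite hn
  have h2 : (2 : ℝ) ≤ n := by exact_mod_cast hn
  let κ : Measure ℝ := (volume.restrict (Ioi (0 : ℝ))).withDensity
    (fun ρ => ENNReal.ofReal (ρ ^ (n - 1)))
  let μ' : Measure (En n) := (κ.prod (snu n)).map (fun p : ℝ × En n => p.1 • p.2)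
  have hm : Measurable (fun p : ℝ × En n => p.1 • p.2) := by fun_prop
  have hdm : Measurable (fun ρ : ℝ => ENNReal.ofReal (ρ ^ (n - 1))) := by fun_prop
  have hle : μ' ≤ C • volume := by
    rw [← hCe]
    refine Measure.le_iff.2 fun A hA => ?_
    have h := eilenberg_norm (n := n) (d := (n : ℝ) - 1) (by linarith) A
    rw [sub_add_cancel] at h
    refine le_trans ?_ h
    rw [Measure.map_apply hm hA, Measure.prod_apply (hm hA),
      lintegral_withDensity_eq_lintegral_mul _ hdm (measurable_measure_prodMk_left (hm hA))]
    refine le_trans (lintegral_mono_ae ?_) (setLIntegral_le_lintegral (Ioi (0 : ℝ)) _)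
    filter_upwards [ae_restrict_mem measurableSet_Ioi] with t ht
    have ht0 : 0 < t := ht
    have e : A ∩ {x | ‖x‖ = t} = A ∩ sphere 0 t := by
      ext x; simp
    rw [e, sphere_inter_eq 0 ht0, snu_image hn 0 ht0, Pi.mul_apply, snu, Measure.restrict_apply]
    · simp only [zero_add]; rfl
    · exact measurable_prodMk_left (hm hA)
  intro F hF c
  have hFc : Measurable fun ξ => F (c + ξ) := by fun_prop
  calc ∫⁻ ρ in Ioi (0 : ℝ), ENNReal.ofReal (ρ ^ (n - 1)) * ∫⁻ ω, F (c + ρ • ω) ∂(snu n)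
      = ∫⁻ ξ, F (c + ξ) ∂μ' := by
        rw [lintegral_map hFc hm, lintegral_prod _ (show Measurable fun a : ℝ × En n => F (c + a.1 • a.2) from hFc.comp hm).aemeasurable,
          lintegral_withDensity_eq_lintegral_mul _ hdm]
        · rfl
        · exact (show Measurable fun a : ℝ × En n => F (c + a.1 • a.2) from hFc.comp hm).lintegral_prod_right'
    _ ≤ ∫⁻ ξ, F (c + ξ) ∂(C • volume) := lintegral_mono' hle le_rfl
    _ = C * ∫⁻ ξ, F ξ := by
        rw [lintegral_smul_measure, smul_eq_mul, lintegral_add_left_eq_self]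
end

theorem tube_half {N r : ℝ} (hN : 0 < N) (ψ : ℝ → ℝ≥0∞) :
    ∫⁻ u in {u : ℝ | 0 < u ∧ u ^ 2 + r ^ 2 ≤ N * u ^ 2}, ψ (√(u ^ 2 + r ^ 2))
      ≤ ENNReal.ofReal (√N) * ∫⁻ t, ψ t := by
  set S := {u : ℝ | 0 < u ∧ u ^ 2 + r ^ 2 ≤ N * u ^ 2} with hS
  have hSm : MeasurableSet S := by
    exact MeasurableSet.inter (s₁ := {u : ℝ | 0 < u}) (s₂ := {u : ℝ | u ^ 2 + r ^ 2 ≤ N * u ^ 2})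
      measurableSet_Ioi (measurableSet_le (by fun_prop) (by fun_prop))
  have hd : ∀ u ∈ S, HasDerivWithinAt (fun u => √(u ^ 2 + r ^ 2)) (u / √(u ^ 2 + r ^ 2)) S u := by
    intro u hu
    have h0 : u ^ 2 + r ^ 2 ≠ 0 := by have := hu.1; positivity
    have := ((hasDerivAt_pow 2 u).add_const (r ^ 2)).sqrt h0
    refine (this.congr_deriv ?_).hasDerivWithinAt
    simp; ring
  have hinj : InjOn (fun u => √(u ^ 2 + r ^ 2)) S := by
    intro u hu v hv h
    have h0 : 0 < u := hu.1
    have h1 : 0 < v := hv.1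
    have h2 := (Real.sqrt_inj (by positivity) (by positivity)).1 h
    nlinarith
  have key := lintegral_image_eq_lintegral_abs_deriv_mul hSm hd hinj ψ
  calc ∫⁻ u in S, ψ (√(u ^ 2 + r ^ 2))
      ≤ ∫⁻ u in S, ENNReal.ofReal (√N) *
          (ENNReal.ofReal |u / √(u ^ 2 + r ^ 2)| * ψ (√(u ^ 2 + r ^ 2))) := by
        refine lintegral_mono_ae ?_
        filter_upwards [ae_restrict_mem hSm] with u hu
        rw [← mul_assoc, ← ENNReal.ofReal_mul (by positivity)]
        have h0 : 0 < u := hu.1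
        have hp : 0 < √(u ^ 2 + r ^ 2) := by positivity
        have : 1 ≤ √N * |u / √(u ^ 2 + r ^ 2)| := by
          rw [abs_of_pos (by positivity), mul_div_assoc', le_div_iff₀ hp, one_mul]
          apply Real.sqrt_le_iff.2
          refine ⟨by positivity, ?_⟩
          rw [mul_pow, Real.sq_sqrt hN.le]; exact hu.2
        calc ψ (√(u ^ 2 + r ^ 2)) = 1 * ψ (√(u ^ 2 + r ^ 2)) := (one_mul _).symm
          _ ≤ _ := by gcongr; exact ENNReal.one_le_ofReal.2 this
    _ = ENNReal.ofReal (√N) * ∫⁻ t in (fun u => √(u ^ 2 + r ^ 2)) '' S, ψ t := by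
        rw [key, lintegral_const_mul']
        exact ENNReal.ofReal_ne_top
    _ ≤ _ := by gcongr; exact Measure.restrict_le_self

theorem tube_line {N r : ℝ} (hN : 0 < N) (ψ : ℝ → ℝ≥0∞) :
    ∫⁻ u in {u : ℝ | u ^ 2 + r ^ 2 ≤ N * u ^ 2}, ψ (√(u ^ 2 + r ^ 2))
      ≤ 2 * ENNReal.ofReal (√N) * ∫⁻ t, ψ t := by
  set S := {u : ℝ | 0 < u ∧ u ^ 2 + r ^ 2 ≤ N * u ^ 2} with hS
  have hSm : MeasurableSet S := by
    exact MeasurableSet.inter (s₁ := {u : ℝ | 0 < u}) (s₂ := {u : ℝ | u ^ 2 + r ^ 2 ≤ N * u ^ 2})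
      measurableSet_Ioi (measurableSet_le (by fun_prop) (by fun_prop))
  have hsub : {u : ℝ | u ^ 2 + r ^ 2 ≤ N * u ^ 2} ⊆ (S ∪ Neg.neg ⁻¹' S) ∪ {0} := by
    intro u hu
    rcases lt_trichotomy u 0 with h | h | h
    · left; right
      simp only [hS, mem_preimage, Set.mem_ofPred_eq]
      refine ⟨by linarith, ?_⟩
      simpa using hu
    · right; exact h
    · left; left; exact ⟨h, hu⟩
  have h1 := tube_half (r := r) hN ψ
  have h2 : ∫⁻ u in Neg.neg ⁻¹' S, ψ (√(u ^ 2 + r ^ 2)) = ∫⁻ u in S, ψ (√(u ^ 2 + r ^ 2)) := by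
    have := (Measure.measurePreserving_neg (volume : Measure ℝ)).setLIntegral_comp_preimage_emb
      (MeasurableEquiv.neg ℝ).measurableEmbedding (fun u => ψ (√(u ^ 2 + r ^ 2))) S
    simpa using this
  calc _ ≤ ∫⁻ u in (S ∪ Neg.neg ⁻¹' S) ∪ {0}, ψ (√(u ^ 2 + r ^ 2)) := lintegral_mono_set hsub
    _ ≤ ((∫⁻ u in S, ψ (√(u ^ 2 + r ^ 2))) + ∫⁻ u in Neg.neg ⁻¹' S, ψ (√(u ^ 2 + r ^ 2))) +
        ∫⁻ u in {0}, ψ (√(u ^ 2 + r ^ 2)) :=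
        (lintegral_union_le _ _ _).trans (add_le_add_left (lintegral_union_le _ _ _) _)
    _ ≤ _ := by
        rw [h2]
        simp only [Measure.restrict_singleton, Real.volume_singleton, zero_smul,
          lintegral_zero_measure, add_zero]
        rw [two_mul, add_mul]
        exact add_le_add h1 h1

theorem tube_coord {m : ℕ} {γ : ℝ} (hγ : (m : ℝ) < γ) (i : Fin (m + 1)) :
    ∃ C : ℝ≥0∞, C ≠ ⊤ ∧ ∀ (ψ : ℝ → ℝ≥0∞), Measurable ψ → ∀ b : En (m + 1),
      ∫⁻ ξ in {ξ : En (m + 1) | ‖ξ‖ ^ 2 ≤ ((m : ℝ) + 1) * (ξ i) ^ 2},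
        ψ ‖ξ‖ * ENNReal.ofReal ((1 + ‖ξ - b‖ ^ 2) ^ (-γ / 2)) ≤ C * ∫⁻ t, ψ t := by
  have hIntg : Integrable (fun x : En m => ((1 : ℝ) + ‖x‖ ^ 2) ^ (-γ / 2)) :=
    integrable_rpow_neg_one_add_norm_sq (by simpa using hγ)
  have hγ0 : 0 < γ := lt_of_le_of_lt (Nat.cast_nonneg m) hγ
  have hK := hIntg.lintegral_lt_top
  set K := ∫⁻ x : En m, ENNReal.ofReal (((1 : ℝ) + ‖x‖ ^ 2) ^ (-γ / 2)) with hKd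
  have hN : (0 : ℝ) < (m : ℝ) + 1 := by positivity
  refine ⟨2 * ENNReal.ofReal (√((m : ℝ) + 1)) * K, by finiteness, ?_⟩
  intro ψ hψ b
  have hsm : MeasurableSet {ξ : En (m + 1) | ‖ξ‖ ^ 2 ≤ ((m : ℝ) + 1) * (ξ i) ^ 2} :=
    measurableSet_le (by fun_prop) (by fun_prop)
  rw [← lintegral_indicator hsm]
  set T : En (m + 1) → ℝ≥0∞ := _
  change ∫⁻ ξ, T ξ ≤ _
  -- the coordinates
  let e := (MeasurableEquiv.piFinSuccAbove (fun _ : Fin (m + 1) => ℝ) i).symm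
  have he : MeasurePreserving e := (volume_preserving_piFinSuccAbove (fun _ => ℝ) i).symm
  have h1 : ∫⁻ ξ, T ξ = ∫⁻ p : ℝ × (Fin m → ℝ), T (WithLp.toLp 2 (e p)) := by
    rw [← (PiLp.volume_preserving_toLp (Fin (m + 1))).lintegral_comp_emb
      (MeasurableEquiv.toLp 2 _).measurableEmbedding]
    rw [← he.lintegral_comp_emb e.measurableEmbedding]
  have he1 : ∀ (u : ℝ) (y : Fin m → ℝ), e (u, y) i = u := fun u y => by
    simp only [e, MeasurableEquiv.piFinSuccAbove_symm_apply, Fin.insertNthEquiv_apply,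
      Fin.insertNth_apply_same]
  have he2 : ∀ (u : ℝ) (y : Fin m → ℝ) (j : Fin m), e (u, y) (i.succAbove j) = y j :=
    fun u y j => by
    simp only [e, MeasurableEquiv.piFinSuccAbove_symm_apply, Fin.insertNthEquiv_apply,
      Fin.insertNth_apply_succAbove]
  have hnorm : ∀ (u : ℝ) (y : Fin m → ℝ), ‖(WithLp.toLp 2 (e (u, y)) : En (m + 1))‖ ^ 2
      = u ^ 2 + ‖(WithLp.toLp 2 y : En m)‖ ^ 2 := by
    intro u y
    rw [EuclideanSpace.norm_sq_eq, EuclideanSpace.norm_sq_eq, Fin.sum_univ_succAbove _ i]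
    simp [he1, he2]
  let b' : Fin m → ℝ := fun j => b (i.succAbove j)
  have hb : ∀ (u : ℝ) (y : Fin m → ℝ), ‖(WithLp.toLp 2 (y - b') : En m)‖ ^ 2
      ≤ ‖(WithLp.toLp 2 (e (u, y)) : En (m + 1)) - b‖ ^ 2 := by
    intro u y
    rw [EuclideanSpace.norm_sq_eq, EuclideanSpace.norm_sq_eq, Fin.sum_univ_succAbove _ i]
    simp [he1, he2, b']
    positivity
  have hTm : Measurable fun p : ℝ × (Fin m → ℝ) => T (WithLp.toLp 2 (e p)) := by
    have : Measurable T := by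
      apply Measurable.indicator _ hsm
      fun_prop
    exact this.comp ((MeasurableEquiv.toLp 2 _).measurable.comp e.measurable)
  rw [h1, Measure.volume_eq_prod, lintegral_prod_symm _ hTm.aemeasurable]
  calc ∫⁻ y : Fin m → ℝ, ∫⁻ u : ℝ, T (WithLp.toLp 2 (e (u, y)))
      ≤ ∫⁻ y : Fin m → ℝ, ENNReal.ofReal ((1 + ‖(WithLp.toLp 2 (y - b') : En m)‖ ^ 2) ^ (-γ / 2))
          * (2 * ENNReal.ofReal (√((m : ℝ) + 1)) * ∫⁻ t, ψ t) := by
        refine lintegral_mono fun y => ?_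
        refine le_trans ?_ (mul_le_mul_right
          (tube_line (r := ‖(WithLp.toLp 2 y : En m)‖) hN ψ) _)
        rw [← lintegral_const_mul' _ _ ENNReal.ofReal_ne_top, ← lintegral_indicator]
        · refine lintegral_mono fun u => ?_
          by_cases hu : u ^ 2 + ‖(WithLp.toLp 2 y : En m)‖ ^ 2 ≤ ((m : ℝ) + 1) * u ^ 2
          · rw [indicator_of_mem (by exact hu)]
            refine (indicator_le_self _ _ _).trans ?_
            have e1 : ‖(WithLp.toLp 2 (e (u, y)) : En (m + 1))‖
                = √(u ^ 2 + ‖(WithLp.toLp 2 y : En m)‖ ^ 2) := by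
              rw [← hnorm, Real.sqrt_sq (norm_nonneg _)]
            rw [e1, mul_comm]
            refine mul_le_mul_left (ENNReal.ofReal_le_ofReal ?_) _
            apply Real.rpow_le_rpow_of_nonpos (by positivity)
            · linarith [hb u y]
            · linarith
          · have : (WithLp.toLp 2 (e (u, y)) : En (m + 1)) ∉
                {ξ : En (m + 1) | ‖ξ‖ ^ 2 ≤ ((m : ℝ) + 1) * (ξ i) ^ 2} := by
              intro h
              apply hu
              have h' : ‖(WithLp.toLp 2 (e (u, y)) : En (m + 1))‖ ^ 2
                ≤ ((m : ℝ) + 1) * ((WithLp.toLp 2 (e (u, y)) : En (m + 1)) i) ^ 2 := h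
              rw [hnorm] at h'
              simpa [he1] using h'
            simp only [T]
            rw [indicator_of_notMem this]
            exact zero_le
        · exact measurableSet_le (by fun_prop) (by fun_prop)
    _ = 2 * ENNReal.ofReal (√((m : ℝ) + 1)) * K * ∫⁻ t, ψ t := by
        rw [lintegral_mul_const _ (by fun_prop)]
        have : ∫⁻ y : Fin m → ℝ, ENNReal.ofReal
            ((1 + ‖(WithLp.toLp 2 (y - b') : En m)‖ ^ 2) ^ (-γ / 2)) = K := by
          rw [lintegral_sub_right_eq_self (fun y : Fin m → ℝ => ENNReal.ofReal
            ((1 + ‖(WithLp.toLp 2 y : En m)‖ ^ 2) ^ (-γ / 2))) b', hKd]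
          exact (PiLp.volume_preserving_toLp (Fin m)).lintegral_comp_emb
            (MeasurableEquiv.toLp 2 _).measurableEmbedding
            (fun x : En m => ENNReal.ofReal ((1 + ‖x‖ ^ 2) ^ (-γ / 2)))
        rw [this]; ring

theorem jap_rpow {n : ℕ} (x : En n) (s : ℝ) : jap x ^ s = (1 + ‖x‖ ^ 2) ^ (s / 2) := by
  rw [jap, Real.sqrt_eq_rpow, ← Real.rpow_mul (by positivity)]; congr 1; ring

/-- Uniform integral bound over tubular neighbourhoods of spheres. -/
theorem tube_bound {n : ℕ} (hn : 2 ≤ n) {γ : ℝ} (hγ : (n : ℝ) - 1 < γ) :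
    ∃ C : ℝ≥0∞, C ≠ ⊤ ∧ ∀ (ψ : ℝ → ℝ≥0∞), Measurable ψ → ∀ c a : En n,
      ∫⁻ ξ, ψ ‖ξ - c‖ * ENNReal.ofReal (jap (ξ - a) ^ (-γ)) ≤ C * ∫⁻ t, ψ t := by
  obtain ⟨m, rfl⟩ : ∃ m, n = m + 1 := ⟨n - 1, by omega⟩
  have hγ' : (m : ℝ) < γ := by push_cast at hγ; linarith
  choose C hC hCb using tube_coord (m := m) hγ'
  refine ⟨∑ i, C i, ENNReal.sum_ne_top.2 fun i _ => hC i, ?_⟩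
  intro ψ hψ c a
  have h1 : ∫⁻ ξ, ψ ‖ξ - c‖ * ENNReal.ofReal (jap (ξ - a) ^ (-γ)) =
      ∫⁻ ξ : En (m + 1), ψ ‖ξ‖ * ENNReal.ofReal ((1 + ‖ξ - (a - c)‖ ^ 2) ^ (-γ / 2)) := by
    rw [← lintegral_sub_right_eq_self (fun ξ : En (m + 1) =>
      ψ ‖ξ‖ * ENNReal.ofReal ((1 + ‖ξ - (a - c)‖ ^ 2) ^ (-γ / 2))) c]
    refine lintegral_congr fun ξ => ?_
    have : ξ - c - (a - c) = ξ - a := by abel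
    rw [jap_rpow, this]
  rw [h1, ← setLIntegral_univ]
  have hsub : (univ : Set (En (m + 1))) ⊆
      ⋃ i, {ξ : En (m + 1) | ‖ξ‖ ^ 2 ≤ ((m : ℝ) + 1) * (ξ i) ^ 2} := by
    intro ξ _
    rw [mem_iUnion]
    by_contra hcon
    push Not at hcon
    have h2 : ∀ i, ((m : ℝ) + 1) * (ξ i) ^ 2 < ‖ξ‖ ^ 2 := fun i => by
      have := hcon i
      exact not_le.1 this
    have h3 : ∑ i, ((m : ℝ) + 1) * (ξ i) ^ 2 < ∑ _i : Fin (m + 1), ‖ξ‖ ^ 2 :=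
      Finset.sum_lt_sum_of_nonempty Finset.univ_nonempty fun i _ => h2 i
    rw [← Finset.mul_sum, Finset.sum_const, Finset.card_univ, Fintype.card_fin, nsmul_eq_mul] at h3
    have h4 : ‖ξ‖ ^ 2 = ∑ i, (ξ i) ^ 2 := by
      rw [EuclideanSpace.norm_sq_eq]; simp
    rw [← h4] at h3
    push_cast at h3
    exact lt_irrefl _ h3
  refine (lintegral_mono_set hsub).trans ((lintegral_iUnion_le _ _).trans ?_)
  rw [tsum_fintype, Finset.sum_mul]
  exact Finset.sum_le_sum fun i _ => hCb i ψ hψ _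

theorem absrpow_aux {p ε : ℝ} (hp : -1 < p) (hε : 0 < ε) :
    IntegrableOn (fun s : ℝ => |s - 1| ^ p) (Icc (1 - ε) (1 + ε)) ∧
      ∫ s in Icc (1 - ε) (1 + ε), |s - 1| ^ p = 2 * (ε ^ (p + 1) / (p + 1)) := by
  have hi : IntervalIntegrable (fun x : ℝ => x ^ p) volume 0 ε :=
    intervalIntegral.intervalIntegrable_rpow' hp
  have h1 : IntervalIntegrable (fun x : ℝ => |x| ^ p) volume 0 ε := by
    refine hi.congr fun x hx => ?_
    rw [uIoc_of_le hε.le] at hx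
    simp [abs_of_pos hx.1]
  have h2 : IntervalIntegrable (fun x : ℝ => |x| ^ p) volume (-ε) 0 := by
    have := (IntervalIntegrable.iff_comp_neg (by simp)).1 h1
    simpa using this.symm
  have h3 := h2.trans h1
  have e1 : ∫ x in (0 : ℝ)..ε, |x| ^ p = ε ^ (p + 1) / (p + 1) := by
    have : ∫ x in (0 : ℝ)..ε, |x| ^ p = ∫ x in (0 : ℝ)..ε, x ^ p := by
      refine intervalIntegral.integral_congr fun x hx => ?_
      rw [uIcc_of_le hε.le] at hx
      simp [abs_of_nonneg hx.1]
    rw [this, integral_rpow (Or.inl hp), Real.zero_rpow (by linarith)]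
    simp
  have e2 : ∫ x in (-ε)..0, |x| ^ p = ε ^ (p + 1) / (p + 1) := by
    rw [← e1]
    have := intervalIntegral.integral_comp_neg (a := 0) (b := ε) (fun x : ℝ => |x| ^ p)
    simp only [abs_neg, neg_zero] at this
    exact this.symm
  have e3 := intervalIntegral.integral_add_adjacent_intervals h2 h1
  have h4 : IntervalIntegrable (fun x : ℝ => |x - 1| ^ p) volume (1 - ε) (1 + ε) := by
    have := h3.comp_sub_right 1
    rwa [show -ε + 1 = 1 - ε by ring, show ε + 1 = 1 + ε by ring] at this
  refine ⟨(intervalIntegrable_iff_integrableOn_Icc_of_le (by linarith)).1 h4, ?_⟩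
  rw [integral_Icc_eq_integral_Ioc, ← intervalIntegral.integral_of_le (by linarith)]
  rw [intervalIntegral.integral_comp_sub_right (fun x : ℝ => |x| ^ p) 1]
  rw [show 1 - ε - 1 = -ε by ring, show 1 + ε - 1 = ε by ring, ← e3, e1, e2]; ring

section pv
variable {G G' : ℝ → ℂ} {ε : ℝ}

theorem pv_diff (hG : ∀ s, 0 < s → HasDerivAt G (G' s) s) (hG' : ContinuousOn G' (Ioi 0))
    (hε : 0 < ε) (hε1 : ε ≤ 1 / 2) :
    IntegrableOn (fun u : ℝ => |u - 1| ^ (-(1 / 4) : ℝ) * ‖G' u‖) (Icc (1 - ε) (1 + ε)) ∧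
    ∀ s ∈ Icc (1 - ε) (1 + ε), ‖G s - G 1‖ ≤
      |s - 1| ^ (1 / 4 : ℝ) * ∫ u in Icc (1 - ε) (1 + ε), |u - 1| ^ (-(1 / 4) : ℝ) * ‖G' u‖ := by
  have hsub : Icc (1 - ε) (1 + ε) ⊆ Ioi 0 := fun s hs => by
    have := hs.1; simp only [mem_Ioi]; linarith
  have hIntg : IntegrableOn (fun u : ℝ => |u - 1| ^ (-(1 / 4) : ℝ) * ‖G' u‖)
      (Icc (1 - ε) (1 + ε)) :=
    IntegrableOn.mul_continuousOn (absrpow_aux (by norm_num) hε).1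
      (hG'.mono hsub).norm isCompact_Icc
  refine ⟨hIntg, fun s hs => ?_⟩
  have h1 : (1 : ℝ) ∈ Icc (1 - ε) (1 + ε) := ⟨by linarith, by linarith⟩
  have huI : uIcc 1 s ⊆ Icc (1 - ε) (1 + ε) := uIcc_subset_Icc h1 hs
  have hii : IntervalIntegrable G' volume 1 s :=
    (hG'.mono (huI.trans hsub)).intervalIntegrable
  have hftc := intervalIntegral.integral_eq_sub_of_hasDerivAt
    (fun x hx => hG x (hsub (huI hx))) hii
  rw [← hftc]
  refine (intervalIntegral.norm_integral_le_integral_norm_uIoc).trans ?_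
  have huo : uIoc 1 s ⊆ Icc (1 - ε) (1 + ε) := uIoc_subset_uIcc.trans huI
  rw [← integral_const_mul]
  calc ∫ u in uIoc 1 s, ‖G' u‖ ≤
      ∫ u in uIoc 1 s, |s - 1| ^ (1 / 4 : ℝ) * (|u - 1| ^ (-(1 / 4) : ℝ) * ‖G' u‖) := by
        refine integral_mono_ae (intervalIntegrable_iff.1 hii).norm
          ((hIntg.mono_set huo).const_mul _) ?_
        filter_upwards [ae_restrict_mem measurableSet_uIoc,
          ae_restrict_of_ae (Measure.ae_ne volume (1 : ℝ))] with u hu hu1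
        have hpos : 0 < |u - 1| := abs_pos.2 (sub_ne_zero.2 hu1)
        have hle : |u - 1| ≤ |s - 1| := abs_sub_left_of_mem_uIcc (uIoc_subset_uIcc hu)
        rw [← mul_assoc, Real.rpow_neg hpos.le, ← div_eq_mul_inv]
        refine le_mul_of_one_le_left (norm_nonneg _) ?_
        rw [one_le_div (by positivity)]
        exact Real.rpow_le_rpow hpos.le hle (by norm_num)
    _ ≤ _ := by
        refine setIntegral_mono_set (hIntg.const_mul _) ?_ huo.eventuallyLE
        exact Eventually.of_forall fun u => by positivity

theorem pv_exists (hG : ∀ s, 0 < s → HasDerivAt G (G' s) s) (hG' : ContinuousOn G' (Ioi 0))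
    (hGi : IntegrableOn G (Ioi 0)) (hε : 0 < ε) (hε1 : ε ≤ 1 / 2) :
    ∃ L : ℂ, Tendsto (fun d : ℝ => ∫ r in {r : ℝ | 0 < r ∧ d < |1 - r|}, ((1 - r)⁻¹ : ℝ) • G r)
      (nhdsWithin 0 (Ioi 0)) (nhds L) ∧
      ‖L‖ ≤ (8 * ε ^ (1 / 4 : ℝ) *
          ∫ u in Icc (1 - ε) (1 + ε), |u - 1| ^ (-(1 / 4) : ℝ) * ‖G' u‖)
        + ∫ s in Ioi 0 \ Icc (1 - ε) (1 + ε), |1 - s|⁻¹ * ‖G s‖ := by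
  obtain ⟨hIntg, hdiff⟩ := pv_diff hG hG' hε hε1
  set D := Icc (1 - ε) (1 + ε) with hD
  set M := ∫ u in D, |u - 1| ^ (-(1 / 4) : ℝ) * ‖G' u‖ with hM
  have hM0 : 0 ≤ M := integral_nonneg fun u => by positivity
  have hDm : MeasurableSet D := measurableSet_Icc
  have hsub : D ⊆ Ioi 0 := fun s hs => by
    have := hs.1; simp only [mem_Ioi]; linarith
  have hGc : ContinuousOn G (Ioi 0) := fun s hs => (hG s hs).continuousAt.continuousWithinAt
  have hGn : IntegrableOn (fun s => ‖G s‖) (Ioi 0) := hGi.norm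
  let Y : ℝ → ℂ := fun s => ((1 - s)⁻¹ : ℝ) • (G s - D.indicator (fun _ => G 1) s)
  have hYm : AEStronglyMeasurable Y (volume.restrict (Ioi 0)) := by
    refine AEStronglyMeasurable.smul
      (measurable_const.sub measurable_id).inv.aestronglyMeasurable (AEStronglyMeasurable.sub hGi.1 ?_)
    exact (stronglyMeasurable_const.indicator hDm).aestronglyMeasurable
  have hYD : ∀ s ∈ D, ‖Y s‖ ≤ M * |s - 1| ^ (-(3 / 4) : ℝ) := by
    intro s hs
    simp only [Y, indicator_of_mem hs, norm_smul, norm_inv, Real.norm_eq_abs]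
    rw [abs_sub_comm]
    rcases eq_or_ne s 1 with rfl | h1
    · simp
    have hpos : 0 < |s - 1| := abs_pos.2 (sub_ne_zero.2 h1)
    calc |s - 1|⁻¹ * ‖G s - G 1‖ ≤ |s - 1|⁻¹ * (|s - 1| ^ (1 / 4 : ℝ) * M) := by
          gcongr; exact hdiff s hs
      _ = M * |s - 1| ^ (-(3 / 4) : ℝ) := by
          rw [show (-(3 / 4) : ℝ) = -1 + 1 / 4 by norm_num, Real.rpow_add hpos,
            Real.rpow_neg_one]; ring
  have hYF : ∀ s ∉ D, ‖Y s‖ = |1 - s|⁻¹ * ‖G s‖ := by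
    intro s hs
    simp only [Y, indicator_of_notMem hs, norm_smul, norm_inv, Real.norm_eq_abs, sub_zero]
  have hfar : ∀ s ∉ D, ε < |1 - s| := by
    intro s hs
    by_contra hcon
    rw [not_lt, abs_le] at hcon
    exact hs ⟨by linarith, by linarith⟩
  obtain ⟨ha1, ha2⟩ := absrpow_aux (p := -(3 / 4)) (by norm_num) hε
  have hYiD : IntegrableOn Y D :=
    Integrable.mono' (ha1.const_mul M) (hYm.mono_set hsub)
      ((ae_restrict_mem hDm).mono fun s hs => hYD s hs)
  have hYiF : IntegrableOn Y (Ioi 0 \ D) := by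
    refine Integrable.mono' ((hGn.mono_set sdiff_subset).const_mul ε⁻¹)
      (hYm.mono_set sdiff_subset)
      ((ae_restrict_mem (measurableSet_Ioi.diff hDm)).mono fun s hs => ?_)
    rw [hYF s hs.2]
    have := hfar s hs.2
    gcongr
  have hYi : IntegrableOn Y (Ioi 0) := by
    have := hYiD.union hYiF
    rwa [union_sdiff_cancel hsub] at this
  refine ⟨∫ s in Ioi 0, Y s, ?_, ?_⟩
  · have hlim : Tendsto (fun d : ℝ => ∫ s in Ioi 0, {r : ℝ | d < |1 - r|}.indicator Y s)
        (nhdsWithin 0 (Ioi 0)) (nhds (∫ s in Ioi 0, Y s)) := by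
      have hms : ∀ d : ℝ, MeasurableSet {r : ℝ | d < |1 - r|} := fun d =>
        measurableSet_lt (by fun_prop) (by fun_prop)
      refine tendsto_integral_filter_of_dominated_convergence (fun s => ‖Y s‖)
        (Eventually.of_forall fun d => hYm.indicator (hms d))
        (Eventually.of_forall fun d => Eventually.of_forall fun s => norm_indicator_le_norm_self _ _)
        hYi.norm ?_
      filter_upwards [ae_restrict_of_ae (Measure.ae_ne volume (1 : ℝ))] with s hs
      have hpos : 0 < |1 - s| := abs_pos.2 (sub_ne_zero.2 hs.symm)
      refine tendsto_const_nhds.congr' ?_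
      filter_upwards [nhdsWithin_le_nhds (Iio_mem_nhds hpos)] with d hd
      rw [indicator_of_mem]; exact hd
    refine hlim.congr' ?_
    filter_upwards [self_mem_nhdsWithin] with d hd
    have hd0 : (0 : ℝ) < d := hd
    set A := {r : ℝ | 0 < r ∧ d < |1 - r|} with hA
    have hms : MeasurableSet {r : ℝ | d < |1 - r|} := measurableSet_lt (by fun_prop) (by fun_prop)
    have hAe : A = Ioi 0 ∩ {r : ℝ | d < |1 - r|} := rfl
    have hAm : MeasurableSet A := measurableSet_Ioi.inter hms
    rw [setIntegral_indicator hms, ← hAe]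
    have hAs : A ⊆ Ioi 0 := fun s hs => hs.1
    have i1 : IntegrableOn (fun r => ((1 - r)⁻¹ : ℝ) • G r) A := by
      refine Integrable.mono' ((hGn.mono_set hAs).const_mul d⁻¹)
        (AEStronglyMeasurable.smul
          (measurable_const.sub measurable_id).inv.aestronglyMeasurable (hGi.1.mono_set hAs))
        ((ae_restrict_mem hAm).mono fun s hs => ?_)
      rw [norm_smul, norm_inv, Real.norm_eq_abs]
      have := hs.2.le
      gcongr
    have i2 : IntegrableOn Y A := hYi.mono_set hAs
    have key : (∫ r in A, ((1 - r)⁻¹ : ℝ) • G r) - ∫ r in A, Y r = 0 := by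
      rw [← integral_sub i1 i2]
      have e1 : ∀ r, ((1 - r)⁻¹ : ℝ) • G r - Y r =
          (D.indicator (fun r => (1 - r)⁻¹) r : ℝ) • G 1 := by
        intro r
        by_cases hr : r ∈ D
        · simp only [Y, indicator_of_mem hr, smul_sub]; abel
        · simp only [Y, indicator_of_notMem hr, sub_zero, zero_smul, sub_self]
      simp_rw [e1]
      rw [integral_smul_const]
      have e2 : ∫ r in A, (D.indicator (fun r => (1 - r)⁻¹) r : ℝ) = 0 := by
        rw [← integral_indicator hAm]
        have h := integral_sub_left_eq_self
          (fun r => A.indicator (fun r => (D.indicator (fun r => (1 - r)⁻¹) r : ℝ)) r) volume 2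
        have h' : ∀ r, A.indicator (fun r => (D.indicator (fun r => (1 - r)⁻¹) r : ℝ)) (2 - r)
            = - A.indicator (fun r => (D.indicator (fun r => (1 - r)⁻¹) r : ℝ)) r := by
          intro r
          rw [indicator_indicator]
          have hiff : 2 - r ∈ A ∩ D ↔ r ∈ A ∩ D := by
            simp only [hA, hD, mem_inter_iff, Set.mem_ofPred_eq, mem_Icc,
              show 1 - (2 - r) = -(1 - r) by ring, abs_neg]
            constructor
            · rintro ⟨⟨h1, h2⟩, h3, h4⟩
              exact ⟨⟨by linarith, h2⟩, by linarith, by linarith⟩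
            · rintro ⟨⟨h1, h2⟩, h3, h4⟩
              exact ⟨⟨by linarith, h2⟩, by linarith, by linarith⟩
          by_cases hr : r ∈ A ∩ D
          · rw [indicator_of_mem hr, indicator_of_mem (hiff.2 hr),
              show 1 - (2 - r) = -(1 - r) by ring, inv_neg]
          · rw [indicator_of_notMem hr, indicator_of_notMem (fun h => hr (hiff.1 h)), neg_zero]
        simp_rw [h'] at h
        rw [integral_neg] at h
        linarith
      rw [e2, zero_smul]
    exact (sub_eq_zero.1 key).symm
  · refine (norm_integral_le_integral_norm _).trans ?_
    have hu : Ioi 0 = D ∪ (Ioi 0 \ D) := (union_sdiff_cancel hsub).symm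
    have hsp : ∫ s in Ioi 0, ‖Y s‖ = (∫ s in D, ‖Y s‖) + ∫ s in Ioi 0 \ D, ‖Y s‖ := by
      conv_lhs => rw [hu]
      exact setIntegral_union disjoint_sdiff_right (measurableSet_Ioi.diff hDm)
        hYiD.norm hYiF.norm
    rw [hsp]
    refine add_le_add ?_ (le_of_eq ?_)
    · calc ∫ s in D, ‖Y s‖ ≤ ∫ s in D, M * |s - 1| ^ (-(3 / 4) : ℝ) :=
            setIntegral_mono_on hYiD.norm (ha1.const_mul M) hDm hYD
        _ = 8 * ε ^ (1 / 4 : ℝ) * M := by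
            rw [integral_const_mul, ha2]; norm_num; ring
    · exact setIntegral_congr_fun (measurableSet_Ioi.diff hDm) fun s hs => hYF s hs.2

theorem pv_value (hG : ∀ s, 0 < s → HasDerivAt G (G' s) s) (hG' : ContinuousOn G' (Ioi 0))
    (hε : 0 < ε) (hε1 : ε ≤ 1 / 2) :
    ‖G 1‖ ≤ (2 * ε)⁻¹ * (∫ s in Icc (1 - ε) (1 + ε), ‖G s‖) + ε ^ (1 / 4 : ℝ) *
      ∫ u in Icc (1 - ε) (1 + ε), |u - 1| ^ (-(1 / 4) : ℝ) * ‖G' u‖ := by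
  obtain ⟨hIntg, hdiff⟩ := pv_diff hG hG' hε hε1
  set D := Icc (1 - ε) (1 + ε) with hD
  set M := ∫ u in D, |u - 1| ^ (-(1 / 4) : ℝ) * ‖G' u‖ with hM
  have hM0 : 0 ≤ M := integral_nonneg fun u => by positivity
  have hsub : D ⊆ Ioi 0 := fun s hs => by
    have := hs.1; simp only [mem_Ioi]; linarith
  have hGc : ContinuousOn G D := fun s hs => (hG s (hsub hs)).continuousAt.continuousWithinAt
  have hGi : IntegrableOn G D := hGc.integrableOn_compact isCompact_Icc
  have hpt : ∀ s ∈ D, ‖G 1‖ ≤ ‖G s‖ + ε ^ (1 / 4 : ℝ) * M := by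
    intro s hs
    have h1 := hdiff s hs
    have h2 : |s - 1| ≤ ε := abs_le.2 ⟨by linarith [hs.1], by linarith [hs.2]⟩
    have h3 : |s - 1| ^ (1 / 4 : ℝ) * M ≤ ε ^ (1 / 4 : ℝ) * M := by gcongr
    have h4 := norm_sub_norm_le (G 1) (G s)
    rw [norm_sub_rev] at h4
    linarith
  have hc : ∀ c : ℝ, ∫ _ in D, c = 2 * ε * c := by
    intro c
    rw [setIntegral_const, hD, Real.volume_real_Icc_of_le (by linarith), smul_eq_mul]; ring
  have hfin : IntegrableOn (fun _ : ℝ => ε ^ (1 / 4 : ℝ) * M) D := by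
    exact integrableOn_const (by simp [hD])
  have := setIntegral_mono_on (f := fun _ => ‖G 1‖) (integrableOn_const (by simp [hD]))
    (hGi.norm.add hfin) measurableSet_Icc hpt
  simp only [Pi.add_apply] at this
  rw [integral_add hGi.norm hfin, hc, hc] at this
  have h2 : 0 < 2 * ε := by linarith
  calc ‖G 1‖ = (2 * ε)⁻¹ * (2 * ε * ‖G 1‖) := by field_simp
    _ ≤ (2 * ε)⁻¹ * ((∫ s in D, ‖G s‖) + 2 * ε * (ε ^ (1 / 4 : ℝ) * M)) := by gcongr
    _ = _ := by field_simp
end pv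

theorem snu_ae (n : ℕ) : ∀ᵐ ω ∂(snu n), ‖ω‖ = 1 := by
  rw [snu]
  filter_upwards [ae_restrict_mem (isClosed_sphere.measurableSet)] with ω hω
  simpa using hω

theorem solid_bound_s {n : ℕ} (hn : 2 ≤ n) : ∃ C : ℝ≥0∞, C ≠ ⊤ ∧
    ∀ (F : En n → ℝ≥0∞), Measurable F → ∀ (c : En n) (k : ℝ), 0 < k →
      ∫⁻ s in Ioi (0 : ℝ), ENNReal.ofReal (k * (s * k) ^ (n - 1)) *
        ∫⁻ ω, F (c + (s * k) • ω) ∂(snu n) ≤ C * ∫⁻ ξ, F ξ := by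
  obtain ⟨C, hC, h⟩ := solid_bound hn
  refine ⟨C, hC, fun F hF c k hk => ?_⟩
  refine le_trans (le_of_eq ?_) (h F hF c)
  have hd : ∀ s ∈ Ioi (0 : ℝ), HasDerivWithinAt (fun s : ℝ => s * k) k (Ioi 0) s := fun s _ => by
    simpa using ((hasDerivAt_id s).mul_const k).hasDerivWithinAt
  have hi : InjOn (fun s : ℝ => s * k) (Ioi 0) := fun a _ b _ hab => mul_right_cancel₀ hk.ne' hab
  have him : (fun s : ℝ => s * k) '' Ioi 0 = Ioi 0 := by
    ext x
    constructor
    · rintro ⟨s, hs, rfl⟩; exact mul_pos hs hk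
    · intro hx; exact ⟨x / k, div_pos hx hk, by field_simp⟩
  have := lintegral_image_eq_lintegral_abs_deriv_mul measurableSet_Ioi hd hi
    (fun ρ => ENNReal.ofReal (ρ ^ (n - 1)) * ∫⁻ ω, F (c + ρ • ω) ∂(snu n))
  rw [him] at this
  rw [this]
  refine setLIntegral_congr_fun measurableSet_Ioi fun s hs => ?_
  rw [abs_of_pos hk, ENNReal.ofReal_mul hk.le, mul_assoc]

section J
variable {n : ℕ} {Ψ : En n → ℂ} {B : ℝ}

theorem J_deriv (hn : 2 ≤ n) (hΨ : ContDiff ℝ 1 Ψ) (hB0 : ∀ ξ, ‖Ψ ξ‖ ≤ B)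
    (hB : ∀ ξ, ‖fderiv ℝ Ψ ξ‖ ≤ B) (c : En n) (k : ℝ) :
    (∀ s : ℝ, HasDerivAt (fun s : ℝ => ∫ ω, Ψ (c + (s * k) • ω) ∂(snu n))
      (∫ ω, fderiv ℝ Ψ (c + (s * k) • ω) (k • ω) ∂(snu n)) s) ∧
    Continuous (fun s : ℝ => ∫ ω, fderiv ℝ Ψ (c + (s * k) • ω) (k • ω) ∂(snu n)) := by
  have := snu_finite hn
  have hΨc : Continuous Ψ := hΨ.continuous
  have hdc : Continuous (fderiv ℝ Ψ) := hΨ.continuous_fderiv (by norm_num)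
  have hbd : ∀ᵐ ω ∂(snu n), ∀ s : ℝ, ‖fderiv ℝ Ψ (c + (s * k) • ω) (k • ω)‖ ≤ B * |k| := by
    filter_upwards [snu_ae n] with ω hω s
    calc _ ≤ ‖fderiv ℝ Ψ (c + (s * k) • ω)‖ * ‖k • ω‖ := ContinuousLinearMap.le_opNorm _ _
      _ ≤ B * |k| := by
        rw [norm_smul, hω, Real.norm_eq_abs, mul_one]
        gcongr; exact hB _
  constructor
  · intro s
    refine (hasDerivAt_integral_of_dominated_loc_of_deriv_le (F := fun (s : ℝ) ω => Ψ (c + (s * k) • ω))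
      (F' := fun (s : ℝ) ω => fderiv ℝ Ψ (c + (s * k) • ω) (k • ω))
      (bound := fun _ => B * |k|) (s := univ) univ_mem ?_ ?_ ?_ ?_ ?_ ?_).2
    · exact Eventually.of_forall fun s => (by fun_prop : Continuous _).aestronglyMeasurable
    · refine Integrable.mono' (integrable_const B) (by fun_prop : Continuous _).aestronglyMeasurable
        (Eventually.of_forall fun ω => hB0 _)
    · exact (by fun_prop : Continuous _).aestronglyMeasurable
    · filter_upwards [hbd] with ω hω s _ using hω s
    · exact integrable_const _
    · refine Eventually.of_forall fun ω s _ => ?_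
      have h1 : HasDerivAt (fun s : ℝ => c + (s * k) • ω) (k • ω) s := by
        have := (((hasDerivAt_id s).mul_const k).smul_const ω).const_add c
        simpa using this
      exact ((hΨ.differentiable (by norm_num)) _).hasFDerivAt.comp_hasDerivAt s h1
  · refine continuous_of_dominated (bound := fun _ => B * |k|) ?_ ?_ (integrable_const _) ?_
    · exact fun s => (by fun_prop : Continuous _).aestronglyMeasurable
    · exact fun s => by filter_upwards [hbd] with ω hω using hω s
    · exact Eventually.of_forall fun ω => by fun_prop
end J

/-- the scalar amplitude -/
def amp (n : ℕ) (k s : ℝ) : ℝ := (k * (s + 1))⁻¹ * (s * k) ^ (n - 1)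

def amp' (n : ℕ) (k s : ℝ) : ℝ :=
  amp n k s * (((n - 1 : ℕ) : ℝ) / s - 1 / (s + 1))

theorem amp_nonneg {n : ℕ} {k s : ℝ} (hk : 0 < k) (hs : 0 < s) : 0 ≤ amp n k s := by
  unfold amp; positivity

theorem amp_deriv (n : ℕ) {k s : ℝ} (hk : 0 < k) (hs : 0 < s) :
    HasDerivAt (amp n k) (amp' n k s) s := by
  have h1 : HasDerivAt (fun s : ℝ => (k * (s + 1))⁻¹) (-(k * 1) / (k * (s + 1)) ^ 2) s :=
    (((hasDerivAt_id s).add_const 1).const_mul k).inv (by positivity)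
  have h2 : HasDerivAt (fun s : ℝ => (s * k) ^ (n - 1))
      (((n - 1 : ℕ) : ℝ) * (s * k) ^ (n - 1 - 1) * (1 * k)) s :=
    ((hasDerivAt_id s).mul_const k).pow (n - 1)
  have := h1.mul h2
  refine this.congr_deriv ?_
  unfold amp' amp
  rcases Nat.eq_zero_or_pos (n - 1) with h0 | h0
  · rw [h0]; simp; field_simp
  · obtain ⟨m, hm⟩ : ∃ m, n - 1 = m + 1 := ⟨n - 1 - 1, by omega⟩
    rw [hm]; simp only [Nat.add_sub_cancel, pow_succ]
    field_simp
    ring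

theorem amp'_cont (n : ℕ) {k : ℝ} (hk : 0 < k) : ContinuousOn (amp' n k) (Ioi 0) := by
  unfold amp' amp
  have h1 : ∀ x ∈ Ioi (0 : ℝ), x ≠ 0 := fun x hx => (ne_of_gt hx)
  have h2 : ∀ x ∈ Ioi (0 : ℝ), x + 1 ≠ 0 := fun x hx => by
    have : 0 < x := hx
    positivity
  have h3 : ∀ x ∈ Ioi (0 : ℝ), k * (x + 1) ≠ 0 := fun x hx => mul_ne_zero hk.ne' (h2 x hx)
  fun_prop (disch := assumption)

theorem amp'_le {n : ℕ} (hn : 2 ≤ n) {k s : ℝ} (hk : 0 < k) (hs : 1 / 2 ≤ s) :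
    |amp' n k s| ≤ 2 * n * amp n k s := by
  have hs0 : 0 < s := by linarith
  unfold amp'
  rw [abs_mul, abs_of_nonneg (amp_nonneg hk hs0), mul_comm]
  refine mul_le_mul_of_nonneg_right ?_ (amp_nonneg hk hs0)
  have hc : ((n - 1 : ℕ) : ℝ) = n - 1 := by push_cast [Nat.cast_sub (by omega : 1 ≤ n)]; ring
  have hn' : (2 : ℝ) ≤ n := by exact_mod_cast hn
  have h1 : ((n : ℝ) - 1) / s ≤ 2 * (n - 1) := by
    rw [div_le_iff₀ hs0]; nlinarith
  have h2 : 0 ≤ ((n : ℝ) - 1) / s := div_nonneg (by linarith) hs0.le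
  have h3 : 1 / (s + 1) ≤ 1 := by rw [div_le_iff₀ (by linarith)]; linarith
  have h4 : 0 ≤ 1 / (s + 1) := by positivity
  rw [hc, abs_le]; constructor <;> linarith

theorem ofReal_integral_le {X : Type*} [MeasurableSpace X] {μ : Measure X} {f : X → ℝ}
    (hf : ∀ x, 0 ≤ f x) : ENNReal.ofReal (∫ x, f x ∂μ) ≤ ∫⁻ x, ENNReal.ofReal (f x) ∂μ := by
  have h := enorm_integral_le_lintegral_enorm (μ := μ) f
  rw [Real.enorm_of_nonneg (integral_nonneg hf)] at h
  refine h.trans (le_of_eq (lintegral_congr fun x => Real.enorm_of_nonneg (hf x)))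

def PhiF (τ : ℝ) : ℝ := if |τ| ≤ 1 / 2 then |τ| ^ (-(1 / 4) : ℝ) else |τ|⁻¹

theorem PhiF_nonneg (τ : ℝ) : 0 ≤ PhiF τ := by
  unfold PhiF; split_ifs <;> positivity

theorem PhiF_meas : Measurable PhiF := by
  unfold PhiF
  refine Measurable.ite (measurableSet_le (by fun_prop) (by fun_prop)) ?_ ?_
  · exact (measurable_id.abs).pow_const _
  · exact (measurable_id.abs).inv

def kerF {n : ℕ} (c : En n) (k : ℝ) (w : En n → ℝ) (ξ : En n) : ℝ≥0∞ :=
  ENNReal.ofReal (PhiF (‖ξ - c‖ - k) / (‖ξ - c‖ + k) * w ξ)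

section pt
variable {n : ℕ} {Ψ : En n → ℂ} {w : En n → ℝ} {B : ℝ}

theorem X_bound (hw0 : ∀ ξ, 0 ≤ w ξ) (c : En n) {k s : ℝ} (hk : 0 < k) (hs : 0 < s) :
    ENNReal.ofReal (k * PhiF (k * (s - 1)) * (amp n k s * ∫ ω, w (c + (s * k) • ω) ∂(snu n)))
     ≤ ENNReal.ofReal (k * (s * k) ^ (n - 1)) *
        ∫⁻ ω, kerF c k w (c + (s * k) • ω) ∂(snu n) := by
  have hsk : 0 < s * k := by positivity
  have e : k * PhiF (k * (s - 1)) * (amp n k s * ∫ ω, w (c + (s * k) • ω) ∂(snu n))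
      = (k * (s * k) ^ (n - 1)) *
        ∫ ω, PhiF (s * k - k) / (s * k + k) * w (c + (s * k) • ω) ∂(snu n) := by
    rw [integral_const_mul, amp, show k * (s - 1) = s * k - k by ring,
      show k * (s + 1) = s * k + k by ring]
    field_simp
  rw [e, ENNReal.ofReal_mul (by positivity)]
  gcongr
  refine (ofReal_integral_le fun ω => ?_).trans (le_of_eq (lintegral_congr_ae ?_))
  · exact mul_nonneg (div_nonneg (PhiF_nonneg _) (by positivity)) (hw0 _)
  · filter_upwards [snu_ae n] with ω hω
    rw [kerF, add_sub_cancel_left, norm_smul, hω, Real.norm_eq_abs, abs_of_pos hsk, mul_one]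

theorem near_scalar {n : ℕ} {k s a b A : ℝ} (ha0 : 0 ≤ a) (hb0 : 0 ≤ b) (hk : 1 ≤ k) (hs1 : s ≠ 1)
    (hs : |s - 1| ≤ 1 / (2 * k)) (hAW : 0 ≤ A)
    (ha : a ≤ A) (hb : b ≤ 3 * n * k * A) :
    π * (2 * (1 / (2 * k)))⁻¹ * a + (π + 8) * (1 / (2 * k)) ^ (1 / 4 : ℝ) *
      (|s - 1| ^ (-(1 / 4) : ℝ) * b) ≤ (4 + 36 * n) * (k * PhiF (k * (s - 1)) * A) := by
  have hk0 : 0 < k := by linarith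
  have hpos : 0 < |s - 1| := abs_pos.2 (sub_ne_zero.2 hs1)
  have hab : |k * (s - 1)| = k * |s - 1| := by rw [abs_mul, abs_of_pos hk0]
  have hle : |k * (s - 1)| ≤ 1 / 2 := by
    rw [hab]; calc k * |s - 1| ≤ k * (1 / (2 * k)) := by gcongr
      _ = 1 / 2 := by field_simp
  have hP : PhiF (k * (s - 1)) = (k * |s - 1|) ^ (-(1 / 4) : ℝ) := by
    rw [PhiF, if_pos hle, hab]
  have hP1 : 1 ≤ PhiF (k * (s - 1)) := by
    rw [hP]
    refine Real.one_le_rpow_of_pos_of_le_one_of_nonpos (by positivity) ?_ (by norm_num)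
    rw [← hab]; linarith
  have h1 : (1 / (2 * k)) ^ (1 / 4 : ℝ) * |s - 1| ^ (-(1 / 4) : ℝ) ≤ PhiF (k * (s - 1)) := by
    rw [hP, Real.rpow_neg hpos.le, Real.rpow_neg (by positivity),
      Real.mul_rpow hk0.le hpos.le, mul_inv]
    gcongr
    rw [← Real.inv_rpow hk0.le]
    refine Real.rpow_le_rpow (by positivity) ?_ (by norm_num)
    rw [← one_div]; gcongr; linarith
  set P := PhiF (k * (s - 1))
  have hpi := Real.pi_le_four
  have hpi0 := Real.pi_pos
  have e1 : (2 * (1 / (2 * k)))⁻¹ = k := by field_simp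
  rw [e1]
  have hn0 : (0 : ℝ) ≤ n := Nat.cast_nonneg n
  set E := (1 / (2 * k)) ^ (1 / 4 : ℝ)
  have hE : 0 ≤ E := by positivity
  have hS : 0 ≤ |s - 1| ^ (-(1 / 4) : ℝ) := by positivity
  have t1 : π * k * a ≤ 4 * (k * P * A) := by
    calc π * k * a ≤ 4 * k * A := by gcongr
      _ = 4 * (k * 1 * A) := by ring
      _ ≤ _ := by gcongr
  have t2 : (π + 8) * E * (|s - 1| ^ (-(1 / 4) : ℝ) * b) ≤ 36 * n * (k * P * A) := by
    calc (π + 8) * E * (|s - 1| ^ (-(1 / 4) : ℝ) * b)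
        ≤ 12 * E * (|s - 1| ^ (-(1 / 4) : ℝ) * (3 * n * k * A)) := by gcongr; linarith
      _ = 36 * n * k * A * (E * |s - 1| ^ (-(1 / 4) : ℝ)) := by ring
      _ ≤ 36 * n * k * A * P := by gcongr
      _ = _ := by ring
  linarith

theorem pt_bound (hn : 2 ≤ n) : ∃ C : ℝ≥0∞, C ≠ ⊤ ∧
    ∀ (Ψ : En n → ℂ) (w : En n → ℝ) (B : ℝ), ContDiff ℝ 1 Ψ → Continuous w →
      (∀ ξ, ‖Ψ ξ‖ ≤ w ξ) → (∀ ξ, ‖fderiv ℝ Ψ ξ‖ ≤ w ξ) → (∀ ξ, w ξ ≤ B) → Integrable w →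
      ∀ (c : En n) (k : ℝ), 0 < k → ∃ L : ℂ,
        Tendsto (fun d : ℝ => ∫ r in {r : ℝ | 0 < r ∧ d < |1 - r|}, ((1 - r)⁻¹ : ℝ) •
          (amp n k r • ∫ ω, Ψ (c + (r * k) • ω) ∂(snu n))) (nhdsWithin 0 (Ioi 0)) (nhds L) ∧
        (1 ≤ k → ENNReal.ofReal (π * ‖amp n k 1 • ∫ ω, Ψ (c + ((1 : ℝ) * k) • ω) ∂(snu n)‖ + ‖L‖)
          ≤ C * ∫⁻ ξ, kerF c k w ξ) := by
  obtain ⟨C, hC, hsol⟩ := solid_bound_s hn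
  refine ⟨ENNReal.ofReal (4 + 36 * n) * C, ENNReal.mul_ne_top ENNReal.ofReal_ne_top hC, ?_⟩
  intro Ψ w B hΨ hw hΨw hdw hwB hwi c k hk
  have := snu_finite hn
  have hw0 : ∀ ξ, 0 ≤ w ξ := fun ξ => (norm_nonneg _).trans (hΨw ξ)
  obtain ⟨hJ, hJc⟩ := J_deriv hn hΨ (fun ξ => (hΨw ξ).trans (hwB ξ))
    (fun ξ => (hdw ξ).trans (hwB ξ)) c k
  have hwint : ∀ s : ℝ, Integrable (fun ω => w (c + (s * k) • ω)) (snu n) := fun s =>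
    Integrable.mono' (integrable_const B) (by fun_prop : Continuous _).aestronglyMeasurable
      (Eventually.of_forall fun ω => by
        rw [Real.norm_eq_abs, abs_of_nonneg (hw0 _)]; exact hwB _)
  set J : ℝ → ℂ := fun s => ∫ ω, Ψ (c + (s * k) • ω) ∂(snu n) with hJd
  set J' : ℝ → ℂ := fun s => ∫ ω, fderiv ℝ Ψ (c + (s * k) • ω) (k • ω) ∂(snu n) with hJd'
  set W : ℝ → ℝ := fun s => ∫ ω, w (c + (s * k) • ω) ∂(snu n) with hWd
  have hW0 : ∀ s, 0 ≤ W s := fun s => integral_nonneg fun ω => hw0 _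
  have hJW : ∀ s, ‖J s‖ ≤ W s := fun s =>
    norm_integral_le_of_norm_le (hwint s) (Eventually.of_forall fun ω => hΨw _)
  have hJW' : ∀ s, ‖J' s‖ ≤ k * W s := fun s => by
    rw [hWd]; simp only; rw [← integral_const_mul]
    refine norm_integral_le_of_norm_le ((hwint s).const_mul k) ?_
    filter_upwards [snu_ae n] with ω hω
    calc _ ≤ ‖fderiv ℝ Ψ (c + (s * k) • ω)‖ * ‖k • ω‖ := ContinuousLinearMap.le_opNorm _ _
      _ ≤ k * w (c + (s * k) • ω) := by
        rw [norm_smul, hω, Real.norm_eq_abs, abs_of_pos hk, mul_one, mul_comm]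
        gcongr; exact hdw _
  set G : ℝ → ℂ := fun s => amp n k s • J s with hGd
  set G' : ℝ → ℂ := fun s => amp n k s • J' s + amp' n k s • J s with hGd'
  have hG : ∀ s, 0 < s → HasDerivAt G (G' s) s := fun s hs => (amp_deriv n hk hs).smul (hJ s)
  have hJcont : Continuous J := continuous_iff_continuousAt.2 fun s => (hJ s).continuousAt
  have hampc : ContinuousOn (amp n k) (Ioi 0) := fun s hs =>
    (amp_deriv n hk hs).continuousAt.continuousWithinAt
  have hG' : ContinuousOn G' (Ioi 0) :=
    (hampc.smul hJc.continuousOn).add ((amp'_cont n hk).smul hJcont.continuousOn)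
  have hGc : ContinuousOn G (Ioi 0) := hampc.smul hJcont.continuousOn
  have hGA : ∀ s, 0 < s → ‖G s‖ ≤ amp n k s * W s := fun s hs => by
    rw [hGd]; simp only
    rw [norm_smul, Real.norm_eq_abs, abs_of_nonneg (amp_nonneg hk hs)]
    exact mul_le_mul_of_nonneg_left (hJW s) (amp_nonneg hk hs)
  have hGA' : 1 ≤ k → ∀ s, 1 / 2 ≤ s → ‖G' s‖ ≤ 3 * n * k * (amp n k s * W s) := by
    intro hk1 s hs
    have hs0 : 0 < s := by linarith
    have ha := amp_nonneg (n := n) hk hs0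
    have hn' : (2 : ℝ) ≤ n := by exact_mod_cast hn
    have hAW : 0 ≤ amp n k s * W s := mul_nonneg ha (hW0 s)
    calc ‖G' s‖ ≤ ‖amp n k s • J' s‖ + ‖amp' n k s • J s‖ := norm_add_le _ _
      _ ≤ amp n k s * (k * W s) + (2 * n * amp n k s) * W s := by
        rw [norm_smul, norm_smul, Real.norm_eq_abs, Real.norm_eq_abs, abs_of_nonneg ha]
        gcongr
        · exact hJW' s
        · exact amp'_le hn hk hs
        · exact hJW s
      _ = (k + 2 * n) * (amp n k s * W s) := by ring
      _ ≤ _ := by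
        gcongr
        nlinarith
  have hGi : IntegrableOn G (Ioi 0) := by
    refine ⟨hGc.aestronglyMeasurable measurableSet_Ioi, ?_⟩
    have hb : ∫⁻ s in Ioi (0 : ℝ), ‖G s‖ₑ ≤ ENNReal.ofReal ((k * k)⁻¹) *
        (C * ∫⁻ ξ, ENNReal.ofReal (w ξ)) := by
      refine le_trans ?_ (mul_le_mul_right (hsol (fun ξ => ENNReal.ofReal (w ξ))
        (hw.measurable.ennreal_ofReal) c k hk) _)
      rw [← lintegral_const_mul' _ _ ENNReal.ofReal_ne_top]
      refine setLIntegral_mono' measurableSet_Ioi fun s hs => ?_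
      have hs0 : 0 < s := hs
      rw [← mul_assoc, ← ENNReal.ofReal_mul (by positivity), ← ofReal_norm]
      calc ENNReal.ofReal ‖G s‖ ≤ ENNReal.ofReal
            (((k * k)⁻¹ * (k * (s * k) ^ (n - 1))) * W s) := by
            refine ENNReal.ofReal_le_ofReal ((hGA s hs).trans ?_)
            refine mul_le_mul_of_nonneg_right ?_ (hW0 s)
            unfold amp
            rw [← mul_assoc, show (k * k)⁻¹ * k = k⁻¹ by field_simp]
            gcongr
            nlinarith
        _ ≤ _ := by
            rw [ENNReal.ofReal_mul (by positivity)]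
            gcongr
            exact ofReal_integral_le fun ω => hw0 _
    refine lt_of_le_of_lt hb ?_
    refine ENNReal.mul_lt_top ENNReal.ofReal_lt_top (ENNReal.mul_lt_top hC.lt_top ?_)
    have := hwi.2
    rw [hasFiniteIntegral_iff_norm] at this
    simpa [Real.norm_eq_abs, abs_of_nonneg (hw0 _)] using this
  set ε : ℝ := 1 / (2 * max k 1) with hεd
  have hmax : 1 ≤ max k 1 := le_max_right _ _
  have hε : 0 < ε := by positivity
  have hε1 : ε ≤ 1 / 2 := by
    rw [hεd]; gcongr; linarith
  obtain ⟨L, hL, hLb⟩ := pv_exists hG hG' hGi hε hε1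
  refine ⟨L, hL, fun hk1 => ?_⟩
  have hval := pv_value hG hG' hε hε1
  have hIntg := (pv_diff hG hG' hε hε1).1
  have hεk : ε = 1 / (2 * k) := by rw [hεd, max_eq_left hk1]
  set D := Icc (1 - ε) (1 + ε) with hD
  have hDm : MeasurableSet D := measurableSet_Icc
  have hsub : D ⊆ Ioi 0 := fun s hs => by
    have := hs.1; simp only [mem_Ioi]; linarith
  set X : ℝ → ℝ≥0∞ := fun s => ENNReal.ofReal (k * (s * k) ^ (n - 1)) *
        ∫⁻ ω, kerF c k w (c + (s * k) • ω) ∂(snu n) with hX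
  set Nf : ℝ → ℝ := fun s => π * (2 * ε)⁻¹ * ‖G s‖ + (π + 8) * ε ^ (1 / 4 : ℝ) *
      (|s - 1| ^ (-(1 / 4) : ℝ) * ‖G' s‖) with hNf
  have hNf0 : ∀ s, 0 ≤ Nf s := fun s => by
    have := Real.pi_pos
    simp only [hNf]; positivity
  have hNint : ∫ s in D, Nf s = π * (2 * ε)⁻¹ * (∫ s in D, ‖G s‖) +
      (π + 8) * ε ^ (1 / 4 : ℝ) * ∫ s in D, |s - 1| ^ (-(1 / 4) : ℝ) * ‖G' s‖ := by
    simp only [hNf]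
    have hGD : IntegrableOn G D := hGi.mono_set hsub
    rw [integral_add (hGD.norm.const_mul _) (hIntg.const_mul _), integral_const_mul,
      integral_const_mul]
  have hsum : π * ‖G 1‖ + ‖L‖ ≤ (∫ s in D, Nf s) + ∫ s in Ioi 0 \ D, |1 - s|⁻¹ * ‖G s‖ := by
    rw [hNint]
    have := mul_le_mul_of_nonneg_left hval Real.pi_pos.le
    linarith
  have hnear : ENNReal.ofReal (∫ s in D, Nf s) ≤ ENNReal.ofReal (4 + 36 * n) * ∫⁻ s in D, X s := by
    refine (ofReal_integral_le hNf0).trans ?_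
    rw [← lintegral_const_mul' _ _ ENNReal.ofReal_ne_top]
    refine lintegral_mono_ae ?_
    filter_upwards [ae_restrict_mem hDm, ae_restrict_of_ae (Measure.ae_ne volume (1 : ℝ))]
      with s hs hs1
    have hs0 : 0 < s := hsub hs
    have hsh : 1 / 2 ≤ s := by linarith [hs.1]
    have hs2 : |s - 1| ≤ ε := abs_le.2 ⟨by linarith [hs.1], by linarith [hs.2]⟩
    have h1 := near_scalar (n := n) (norm_nonneg (G s)) (norm_nonneg (G' s)) hk1 hs1
      (by rw [← hεk]; exact hs2)
      (mul_nonneg (amp_nonneg hk hs0) (hW0 s)) (hGA s hs0) (hGA' hk1 s hsh)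
    rw [← hεk] at h1
    refine (ENNReal.ofReal_le_ofReal h1).trans ?_
    rw [ENNReal.ofReal_mul (by positivity)]
    gcongr
    exact X_bound hw0 c hk hs0
  have hfar : ENNReal.ofReal (∫ s in Ioi 0 \ D, |1 - s|⁻¹ * ‖G s‖) ≤
      ENNReal.ofReal (4 + 36 * n) * ∫⁻ s in Ioi 0 \ D, X s := by
    refine (ofReal_integral_le fun s => by positivity).trans ?_
    rw [← lintegral_const_mul' _ _ ENNReal.ofReal_ne_top]
    refine setLIntegral_mono' (measurableSet_Ioi.diff hDm) fun s hs => ?_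
    have hs0 : 0 < s := hs.1
    have hfar1 : ε < |s - 1| := by
      by_contra hcon
      rw [not_lt, abs_le] at hcon
      exact hs.2 ⟨by linarith, by linarith⟩
    have hab : |k * (s - 1)| = k * |s - 1| := by rw [abs_mul, abs_of_pos hk]
    have hgt : ¬ |k * (s - 1)| ≤ 1 / 2 := by
      rw [not_le, hab]
      calc (1 / 2 : ℝ) = k * ε := by rw [hεk]; field_simp
        _ < _ := by gcongr
    have hP : k * PhiF (k * (s - 1)) = |1 - s|⁻¹ := by
      rw [PhiF, if_neg hgt, hab, abs_sub_comm 1 s, mul_inv, ← mul_assoc, mul_inv_cancel₀ hk.ne',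
        one_mul]
    refine le_trans ?_ (le_mul_of_one_le_left (zero_le (a := X s)) ?_)
    · refine le_trans ?_ (X_bound hw0 c hk hs0)
      refine ENNReal.ofReal_le_ofReal ?_
      rw [hP]
      gcongr
      exact hGA s hs0
    · rw [ENNReal.one_le_ofReal]
      have : (0 : ℝ) ≤ n := Nat.cast_nonneg n
      linarith
  calc ENNReal.ofReal (π * ‖G 1‖ + ‖L‖)
      ≤ ENNReal.ofReal ((∫ s in D, Nf s) + ∫ s in Ioi 0 \ D, |1 - s|⁻¹ * ‖G s‖) :=
        ENNReal.ofReal_le_ofReal hsum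
    _ ≤ _ := ENNReal.ofReal_add_le
    _ ≤ ENNReal.ofReal (4 + 36 * n) * (∫⁻ s in D, X s)
        + ENNReal.ofReal (4 + 36 * n) * ∫⁻ s in Ioi 0 \ D, X s := add_le_add hnear hfar
    _ = ENNReal.ofReal (4 + 36 * n) * ∫⁻ s in Ioi 0, X s := by
        rw [← mul_add]
        congr 1
        rw [← lintegral_inter_add_sdiff X (Ioi 0) hDm, inter_eq_self_of_subset_right hsub]
    _ ≤ ENNReal.ofReal (4 + 36 * n) * (C * ∫⁻ ξ, kerF c k w ξ) := by
        gcongr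
        refine hsol _ ?_ c k hk
        unfold kerF
        have := PhiF_meas
        have := hw.measurable
        refine Measurable.ennreal_ofReal (Measurable.mul (Measurable.div ?_ ?_) this)
        · exact PhiF_meas.comp (by fun_prop)
        · fun_prop
    _ = _ := by rw [mul_assoc]

end pt

theorem PhiF_sq_lint : ∫⁻ τ, ENNReal.ofReal (PhiF τ ^ 2) ≠ ⊤ := by
  have h1 := (absrpow_aux (p := -(1 / 2)) (ε := 1 / 2) (by norm_num) (by norm_num)).1
  have h2 : Integrable (fun τ : ℝ => 5 * (1 + τ ^ 2)⁻¹) := integrable_inv_one_add_sq.const_mul 5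
  have h1' := (integrable_indicator_iff measurableSet_Icc).2 h1
  have h3 := (h1'.comp_add_right 1).add h2
  have h4 : Integrable (fun τ => PhiF τ ^ 2) := by
    refine Integrable.mono' h3 (PhiF_meas.pow_const 2).aestronglyMeasurable
      (Eventually.of_forall fun τ => ?_)
    rw [Real.norm_eq_abs, abs_of_nonneg (sq_nonneg _)]
    simp only [Pi.add_apply]
    unfold PhiF
    split_ifs with h
    · have hm : τ + 1 ∈ Icc (1 - 1 / 2 : ℝ) (1 + 1 / 2) := by
        rw [abs_le] at h; constructor <;> linarith [h.1, h.2]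
      rw [indicator_of_mem hm, add_sub_cancel_right, ← Real.rpow_natCast, ← Real.rpow_mul (abs_nonneg _)]
      norm_num
      positivity
    · have hh : 1 / 2 < |τ| := not_le.1 h
      have hn : 0 ≤ (Icc (1 - 1 / 2 : ℝ) (1 + 1 / 2)).indicator
          (fun s => |s - 1| ^ (-(1 / 2) : ℝ)) (τ + 1) :=
        indicator_nonneg (fun s _ => by positivity) _
      have h5 : (|τ|⁻¹) ^ 2 ≤ 5 * (1 + τ ^ 2)⁻¹ := by
        have h6 : 1 / 4 < τ ^ 2 := by rw [← sq_abs]; nlinarith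
        rw [inv_pow, sq_abs, ← div_eq_mul_inv, ← one_div, div_le_div_iff₀ (by linarith) (by linarith)]
        linarith
      linarith
  exact (Integrable.lintegral_lt_top h4).ne

theorem weight_scalar {a b e T α β : ℝ} (ha : 1 ≤ a) (hb : 1 ≤ b) (he : 0 < e) (hT : 1 ≤ T)
    (hα : 0 ≤ α) (hαβ : α ≤ β + 1) (h1 : e ≤ 3 * max a b) (h2 : max a b ≤ 3 * T) :
    e ^ α * T⁻¹ * (a ^ (-β) * b ^ (-β)) ≤
      3 ^ α * 3 * (a ^ (-(2 * β + 1 - α)) + b ^ (-(2 * β + 1 - α))) := by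
  have key : ∀ a b : ℝ, 1 ≤ a → a ≤ b → e ≤ 3 * b → b ≤ 3 * T →
      e ^ α * T⁻¹ * (a ^ (-β) * b ^ (-β)) ≤ 3 ^ α * 3 * a ^ (-(2 * β + 1 - α)) := by
    intro a b ha hab h1 h2
    have ha0 : 0 < a := by linarith
    have hb0 : 0 < b := by linarith
    have hT0 : 0 < T := by linarith
    have e1 : e ^ α ≤ 3 ^ α * b ^ α := by
      rw [← Real.mul_rpow (by norm_num) hb0.le]
      exact Real.rpow_le_rpow he.le h1 hα
    have e2 : T⁻¹ ≤ 3 * b⁻¹ := by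
      rw [← div_eq_mul_inv, inv_eq_one_div, div_le_div_iff₀ hT0 hb0]; linarith
    calc e ^ α * T⁻¹ * (a ^ (-β) * b ^ (-β))
        ≤ (3 ^ α * b ^ α) * (3 * b⁻¹) * (a ^ (-β) * b ^ (-β)) := by gcongr
      _ = 3 ^ α * 3 * (b ^ (α + -1 + -β) * a ^ (-β)) := by
          rw [Real.rpow_add hb0, Real.rpow_add hb0, Real.rpow_neg_one]; ring
      _ ≤ 3 ^ α * 3 * (a ^ (α + -1 + -β) * a ^ (-β)) := by
          have e3 := Real.rpow_le_rpow_of_nonpos ha0 hab (show α + -1 + -β ≤ 0 by linarith)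
          exact mul_le_mul_of_nonneg_left (mul_le_mul_of_nonneg_right e3 (by positivity))
            (by positivity)
      _ = _ := by rw [← Real.rpow_add ha0]; congr 2; ring
  have ha0 : 0 < a := by linarith
  have hb0 : 0 < b := by linarith
  rcases le_total a b with hab | hab
  · rw [max_eq_right hab] at h1 h2
    refine (key a b ha hab h1 h2).trans ?_
    have : 0 ≤ b ^ (-(2 * β + 1 - α)) := by positivity
    gcongr; linarith
  · rw [max_eq_left hab] at h1 h2
    rw [mul_comm (a ^ (-β))]
    refine (key b a hb hab h1 h2).trans ?_
    have : 0 ≤ a ^ (-(2 * β + 1 - α)) := by positivity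
    gcongr; linarith

theorem one_le_jap {n : ℕ} (x : En n) : 1 ≤ jap x := by
  unfold jap; rw [Real.one_le_sqrt]; nlinarith [sq_nonneg ‖x‖]
theorem norm_le_jap {n : ℕ} (x : En n) : ‖x‖ ≤ jap x := by
  unfold jap; exact Real.le_sqrt_of_sq_le (by linarith)
theorem jap_le {n : ℕ} (x : En n) : jap x ≤ 1 + ‖x‖ := by
  unfold jap; rw [Real.sqrt_le_left (by positivity)]; nlinarith [norm_nonneg x]
theorem jap_cont {n : ℕ} : Continuous (jap : En n → ℝ) := by unfold jap; fun_prop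

theorem weight_vec {n : ℕ} {θ η ξ : En n} {k α β : ℝ} (hθ : ‖θ‖ = 1) (hk : 1 ≤ k) (hkη : ‖η‖ ≤ k)
    (hα : 0 ≤ α) (hαβ : α ≤ β + 1) :
    jap η ^ α * (‖ξ - -(k • θ)‖ + k)⁻¹ * (jap ξ ^ (-β) * jap (η - ξ) ^ (-β)) ≤
      3 ^ α * 3 * (jap ξ ^ (-(2 * β + 1 - α)) + jap (η - ξ) ^ (-(2 * β + 1 - α))) := by
  have hkθ : ‖k • θ‖ = k := by
    rw [norm_smul, hθ, Real.norm_eq_abs, abs_of_pos (by linarith), mul_one]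
  have hξ : ‖ξ‖ ≤ ‖ξ - -(k • θ)‖ + k := by
    have := norm_add_le (ξ - -(k • θ)) (-(k • θ))
    rw [sub_add_cancel, norm_neg, hkθ] at this; exact this
  have hT : 1 ≤ ‖ξ - -(k • θ)‖ + k := by linarith [norm_nonneg (ξ - -(k • θ))]
  have hηT : ‖η‖ ≤ ‖ξ - -(k • θ)‖ + k := by linarith [norm_nonneg (ξ - -(k • θ))]
  refine weight_scalar (one_le_jap _) (one_le_jap _) (by linarith [one_le_jap η]) hT hα hαβ ?_ ?_
  · have h1 := jap_le η
    have h2 := norm_add_le ξ (η - ξ)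
    rw [add_sub_cancel] at h2
    have h3 := (norm_le_jap ξ).trans (le_max_left (jap ξ) (jap (η - ξ)))
    have h4 := (norm_le_jap (η - ξ)).trans (le_max_right (jap ξ) (jap (η - ξ)))
    have h5 := (one_le_jap ξ).trans (le_max_left (jap ξ) (jap (η - ξ)))
    linarith
  · have h2 := norm_sub_le η ξ
    refine max_le ?_ ?_
    · linarith [jap_le ξ]
    · linarith [jap_le (η - ξ)]

theorem CS_lint {X : Type*} [MeasurableSpace X] {μ : Measure X} {f g : X → ℝ≥0∞}
    (hf : AEMeasurable f μ) (hg : AEMeasurable g μ) :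
    (∫⁻ x, f x * g x ∂μ) ^ 2 ≤ (∫⁻ x, f x ^ 2 ∂μ) * ∫⁻ x, g x ^ 2 ∂μ := by
  have h := ENNReal.lintegral_mul_le_Lp_mul_Lq μ (p := 2) (q := 2)
    (by rw [Real.holderConjugate_iff]; norm_num) hf hg
  simp only [Pi.mul_apply] at h
  have h' := pow_le_pow_left₀ zero_le h 2
  refine h'.trans (le_of_eq ?_)
  have e : ∀ x : ℝ≥0∞, (x ^ (1 / 2 : ℝ)) ^ 2 = x := fun x => by
    rw [← ENNReal.rpow_natCast, ← ENNReal.rpow_mul]; norm_num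
  rw [mul_pow, e, e]
  simp


/-- the majorant -/
def hmaj {n : ℕ} (f : 𝓢(En n, ℂ)) (ξ : En n) : ℝ := ‖f ξ‖ + ‖fderiv ℝ f ξ‖

theorem hmaj_nonneg {n : ℕ} (f : 𝓢(En n, ℂ)) (ξ : En n) : 0 ≤ hmaj f ξ := by
  unfold hmaj; positivity

theorem hmaj_facts {n : ℕ} (f : 𝓢(En n, ℂ)) : Continuous (hmaj f) ∧ (∃ B, ∀ ξ, hmaj f ξ ≤ B) ∧
    Integrable (hmaj f) := by
  have e : ∀ ξ, fderiv ℝ f ξ = SchwartzMap.fderivCLM ℝ (En n) ℂ f ξ := fun ξ => rfl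
  unfold hmaj
  simp_rw [e]
  set g := SchwartzMap.fderivCLM ℝ (En n) ℂ f
  refine ⟨f.continuous.norm.add g.continuous.norm, ?_, f.integrable.norm.add g.integrable.norm⟩
  refine ⟨‖f.toBoundedContinuousFunction‖ + ‖g.toBoundedContinuousFunction‖, fun ξ => ?_⟩
  exact add_le_add (f.toBoundedContinuousFunction.norm_coe_le_norm ξ)
    (g.toBoundedContinuousFunction.norm_coe_le_norm ξ)

section op
variable {n : ℕ}

theorem kval_facts {θ η : En n} (hθ : ‖θ‖ = 1) (h : ⟪η, θ⟫ < 0) :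
    0 < kval θ η ∧ ‖η‖ ≤ kval θ η := by
  have hc : ⟪θ, η⟫ = ⟪η, θ⟫ := real_inner_comm _ _
  have hη : η ≠ 0 := by rintro rfl; simp at h
  have hp : 0 < ‖η‖ := norm_pos_iff.2 hη
  have hle : -⟪θ, η⟫ ≤ ‖η‖ := by
    have := abs_real_inner_le_norm θ η
    rw [hθ, one_mul] at this
    linarith [neg_abs_le ⟪θ, η⟫]
  have hpos : 0 < -⟪θ, η⟫ := by rw [hc]; linarith
  have e : kval θ η = ‖η‖ ^ 2 / (-⟪θ, η⟫) := by unfold kval; rw [neg_div, div_neg]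
  rw [e]
  refine ⟨by positivity, ?_⟩
  rw [le_div_iff₀ hpos]
  nlinarith

theorem sop_eq (hn : 2 ≤ n) {θ η : En n} (hθ : ‖θ‖ = 1) (h : ⟪η, θ⟫ < 0) (q : 𝓢(En n, ℂ)) {r : ℝ}
    (hr : 0 < r) : Sop θ r q η = amp n (kval θ η) r •
      ∫ ω, (𝓕 q : 𝓢(En n, ℂ)) (-(kval θ η • θ) + (r * kval θ η) • ω) *
        (𝓕 q : 𝓢(En n, ℂ)) (η - (-(kval θ η • θ) + (r * kval θ η) • ω)) ∂(snu n) := by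
  obtain ⟨hk, -⟩ := kval_facts hθ h
  have hR : 0 < r * kval θ η := by positivity
  rw [Sop, if_pos h, ewald, restrict_sphere_eq hn _ hR, integral_smul_measure, ← SchwartzMap.fourier_coe,
    integral_map (by fun_prop), amp, ENNReal.toReal_ofReal (by positivity), smul_smul]
  have h1 := (𝓕 q : 𝓢(En n, ℂ)).continuous
  exact (by fun_prop : Continuous _).aestronglyMeasurable

theorem psi_facts (f : 𝓢(En n, ℂ)) (η : En n) :
    ContDiff ℝ 1 (fun ξ => f ξ * f (η - ξ)) ∧
    (∀ ξ, ‖f ξ * f (η - ξ)‖ ≤ hmaj f ξ * hmaj f (η - ξ)) ∧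
    (∀ ξ, ‖fderiv ℝ (fun ξ => f ξ * f (η - ξ)) ξ‖ ≤ hmaj f ξ * hmaj f (η - ξ)) := by
  have hf : ContDiff ℝ 1 f := f.smooth 1
  refine ⟨by fun_prop, fun ξ => ?_, fun ξ => ?_⟩
  · rw [norm_mul]; unfold hmaj; gcongr <;> simp
  · have hd : ∀ x, HasFDerivAt f (fderiv ℝ f x) x := fun x =>
      ((hf.differentiable (by norm_num)) x).hasFDerivAt
    have h2 : HasFDerivAt (fun ξ => f (η - ξ)) (-(fderiv ℝ f (η - ξ))) ξ := by
      have := (hd (η - ξ)).comp ξ ((hasFDerivAt_id ξ).const_sub η)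
      refine HasFDerivAt.congr_fderiv (f := fun ξ => f (η - ξ)) this ?_
      ext v; simp
    have h5 : HasFDerivAt (fun ξ => f ξ * f (η - ξ))
        (f ξ • -(fderiv ℝ f (η - ξ)) + f (η - ξ) • fderiv ℝ f ξ) ξ := (hd ξ).mul h2
    rw [h5.fderiv]
    refine (norm_add_le _ _).trans ?_
    rw [norm_smul, norm_smul, norm_neg]
    unfold hmaj
    have a1 := norm_nonneg (f ξ)
    have a2 := norm_nonneg (f (η - ξ))
    have a3 := norm_nonneg (fderiv ℝ f ξ)
    have a4 := norm_nonneg (fderiv ℝ f (η - ξ))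
    nlinarith [mul_nonneg a1 a2, mul_nonneg a3 a4]

def Hm (β : ℝ) (f : 𝓢(En n, ℂ)) (ξ : En n) : ℝ := jap ξ ^ β * hmaj f ξ

theorem Hm_cont (β : ℝ) (f : 𝓢(En n, ℂ)) : Continuous (Hm β f) := by
  unfold Hm
  refine Continuous.mul ?_ (hmaj_facts f).1
  exact jap_cont.rpow_const fun x => Or.inl (by linarith [one_le_jap x])

theorem Hm_nonneg (β : ℝ) (f : 𝓢(En n, ℂ)) (ξ : En n) : 0 ≤ Hm β f ξ := by
  unfold Hm
  have := one_le_jap ξ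
  have := hmaj_nonneg f ξ
  positivity

/-- weighted Cauchy-Schwarz for the kernel -/
theorem ker_bound (hn : 2 ≤ n) {α β : ℝ} (hα : 0 ≤ α) (hαβ : α ≤ β + 1)
    (hγ : (n : ℝ) - 1 < 2 * (2 * β + 1 - α)) : ∃ C : ℝ≥0∞, C ≠ ⊤ ∧ ∀ (θ η : En n) (k : ℝ)
      (f : 𝓢(En n, ℂ)), ‖θ‖ = 1 → 1 ≤ k → ‖η‖ ≤ k →
      (ENNReal.ofReal (jap η ^ α) *
        ∫⁻ ξ, kerF (-(k • θ)) k (fun ξ => hmaj f ξ * hmaj f (η - ξ)) ξ) ^ 2 ≤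
      C * ∫⁻ ξ, ENNReal.ofReal (Hm β f ξ ^ 2) * ENNReal.ofReal (Hm β f (η - ξ) ^ 2) := by
  obtain ⟨C, hC, htube⟩ := tube_bound hn hγ
  set δ := 2 * β + 1 - α with hδ
  set K : ℝ := 2 * (3 ^ α * 3) ^ 2 with hK
  have hK0 : 0 ≤ K := by positivity
  set I := ∫⁻ τ, ENNReal.ofReal (PhiF τ ^ 2) with hI
  refine ⟨ENNReal.ofReal K * (C * I + C * I), ?_, ?_⟩
  · have := PhiF_sq_lint
    exact ENNReal.mul_ne_top ENNReal.ofReal_ne_top (ENNReal.add_ne_top.2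
      ⟨ENNReal.mul_ne_top hC this, ENNReal.mul_ne_top hC this⟩)
  intro θ η k f hθ hk hkη
  set c : En n := -(k • θ) with hc
  have hj : ∀ x : En n, 0 < jap x := fun x => by linarith [one_le_jap x]
  have hjc : ∀ s : ℝ, Continuous (fun x : En n => jap x ^ s) := fun s =>
    jap_cont.rpow_const fun x => Or.inl (hj x).ne'
  let A : En n → ℝ≥0∞ := fun ξ => ENNReal.ofReal
    (3 ^ α * 3 * (jap ξ ^ (-δ) + jap (η - ξ) ^ (-δ)) * PhiF (‖ξ - c‖ - k))
  let E : En n → ℝ≥0∞ := fun ξ => ENNReal.ofReal (Hm β f ξ * Hm β f (η - ξ))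
  have hPm : Measurable fun ξ : En n => PhiF (‖ξ - c‖ - k) := PhiF_meas.comp (by fun_prop)
  have hAm : Measurable A := by
    refine Measurable.ennreal_ofReal (Measurable.mul ?_ hPm)
    have h1 := hjc (-δ)
    exact (continuous_const.mul (h1.add (h1.comp
      (continuous_const.sub continuous_id)))).measurable
  have hEm : Measurable E := by
    have h1 := Hm_cont β f
    exact (h1.mul (h1.comp (continuous_const.sub continuous_id))).measurable.ennreal_ofReal
  have step1 : ENNReal.ofReal (jap η ^ α) *
        ∫⁻ ξ, kerF c k (fun ξ => hmaj f ξ * hmaj f (η - ξ)) ξ ≤ ∫⁻ ξ, A ξ * E ξ := by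
    rw [← lintegral_const_mul' _ _ ENNReal.ofReal_ne_top]
    refine lintegral_mono fun ξ => ?_
    simp only [kerF, A, E]
    have := hj η
    have hP := PhiF_nonneg (‖ξ - c‖ - k)
    have hj1 := hj ξ
    have hj2 := hj (η - ξ)
    rw [← ENNReal.ofReal_mul (by positivity), ← ENNReal.ofReal_mul (by positivity)]
    refine ENNReal.ofReal_le_ofReal ?_
    have hw := weight_vec (ξ := ξ) hθ hk hkη hα hαβ
    rw [← hc, ← hδ] at hw
    have e1 : ∀ x : En n, hmaj f x = jap x ^ (-β) * Hm β f x := fun x => by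
      rw [Hm, ← mul_assoc, ← Real.rpow_add (hj x)]; simp
    rw [e1 ξ, e1 (η - ξ)]
    have hH := mul_nonneg hP (mul_nonneg (Hm_nonneg β f ξ) (Hm_nonneg β f (η - ξ)))
    calc _ = (jap η ^ α * (‖ξ - c‖ + k)⁻¹ * (jap ξ ^ (-β) * jap (η - ξ) ^ (-β))) *
          (PhiF (‖ξ - c‖ - k) * (Hm β f ξ * Hm β f (η - ξ))) := by
            rw [div_eq_mul_inv]; ring
      _ ≤ _ := mul_le_mul_of_nonneg_right hw hH
      _ = _ := by ring
  have step2 : ∫⁻ ξ, A ξ ^ 2 ≤ ENNReal.ofReal K * (C * I + C * I) := by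
    let ψ : ℝ → ℝ≥0∞ := fun t => ENNReal.ofReal (PhiF (t - k) ^ 2)
    have hψm : Measurable ψ :=
      Measurable.ennreal_ofReal ((PhiF_meas.comp (by fun_prop)).pow_const 2)
    have hψI : ∫⁻ t, ψ t = I := by
      rw [hI]
      exact lintegral_sub_right_eq_self (fun τ => ENNReal.ofReal (PhiF τ ^ 2)) k
    have t0 := htube ψ hψm c 0
    have t1 := htube ψ hψm c η
    rw [hψI] at t0 t1
    have hm0 : Measurable fun ξ : En n => ψ ‖ξ - c‖ * ENNReal.ofReal (jap (ξ - 0) ^ (-(2 * δ))) := by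
      refine (hψm.comp (by fun_prop)).mul ?_
      have h1 := hjc (-(2 * δ))
      exact (h1.comp (continuous_id.sub continuous_const)).measurable.ennreal_ofReal
    calc ∫⁻ ξ, A ξ ^ 2 ≤ ∫⁻ ξ, ENNReal.ofReal K *
          (ψ ‖ξ - c‖ * ENNReal.ofReal (jap (ξ - 0) ^ (-(2 * δ))) +
           ψ ‖ξ - c‖ * ENNReal.ofReal (jap (ξ - η) ^ (-(2 * δ)))) := by
          refine lintegral_mono fun ξ => ?_
          simp only [A, ψ]
          have hj1 := hj ξ
          have hj2 := hj (η - ξ)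
          have hjj : jap (ξ - η) = jap (η - ξ) := by unfold jap; rw [norm_sub_rev]
          have hP := PhiF_nonneg (‖ξ - c‖ - k)
          rw [sub_zero, hjj, ← ENNReal.ofReal_mul (by positivity), ← ENNReal.ofReal_mul (by positivity),
            ← ENNReal.ofReal_add (by positivity) (by positivity), ← ENNReal.ofReal_mul hK0,
            ← ENNReal.ofReal_pow (by positivity)]
          refine ENNReal.ofReal_le_ofReal ?_
          have e2 : ∀ x : ℝ, 0 < x → x ^ (-(2 * δ)) = (x ^ (-δ)) ^ 2 := fun x hx => by
            rw [← Real.rpow_natCast, ← Real.rpow_mul hx.le]; congr 1; push_cast; ring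
          rw [e2 _ hj1, e2 _ hj2]
          set a := jap ξ ^ (-δ)
          set b := jap (η - ξ) ^ (-δ)
          set P := PhiF (‖ξ - c‖ - k)
          have : (3 ^ α * 3 * (a + b) * P) ^ 2 = (3 ^ α * 3) ^ 2 * P ^ 2 * (a + b) ^ 2 := by ring
          rw [this, hK]
          have h3 : (a + b) ^ 2 ≤ 2 * (a ^ 2 + b ^ 2) := by nlinarith [sq_nonneg (a - b)]
          calc _ ≤ (3 ^ α * 3) ^ 2 * P ^ 2 * (2 * (a ^ 2 + b ^ 2)) := by gcongr
            _ = _ := by ring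
      _ ≤ _ := by
          rw [lintegral_const_mul' _ _ ENNReal.ofReal_ne_top, lintegral_add_left hm0]
          gcongr
  calc _ ≤ (∫⁻ ξ, A ξ * E ξ) ^ 2 := pow_le_pow_left₀ zero_le step1 2
    _ ≤ (∫⁻ ξ, A ξ ^ 2) * ∫⁻ ξ, E ξ ^ 2 := CS_lint hAm.aemeasurable hEm.aemeasurable
    _ ≤ _ := by
      refine mul_le_mul' step2 (le_of_eq (lintegral_congr fun ξ => ?_))
      simp only [E]
      rw [← ENNReal.ofReal_pow (mul_nonneg (Hm_nonneg _ _ _) (Hm_nonneg _ _ _)), mul_pow,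
        ENNReal.ofReal_mul (by positivity)]

theorem op_bound (hn : 2 ≤ n) {α β : ℝ} (hα : 0 ≤ α) (hαβ : α ≤ β + 1)
    (hγ : (n : ℝ) - 1 < 2 * (2 * β + 1 - α)) : ∃ C : ℝ≥0∞, C ≠ ⊤ ∧ ∀ θ : En n, ‖θ‖ = 1 →
      ∀ q : 𝓢(En n, ℂ), ∃ P₁ : En n → ℂ, 
        (∀ η : En n, ⟪η, θ⟫ < 0 →
          Tendsto
            (fun d : ℝ => ∫ r in {r : ℝ | 0 < r ∧ d < |1 - r|},
              ((1 - r)⁻¹ : ℝ) • Sop θ r ⇑q η)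
            (nhdsWithin 0 (Ioi 0)) (nhds (P₁ η))) ∧
        ∀ η : En n, ⟪η, θ⟫ < 0 → 1 ≤ ‖η‖ →
          ENNReal.ofReal (jap η ^ (2 * α) * ‖(π : ℂ) * Complex.I * Sop θ 1 ⇑q η + P₁ η‖ ^ 2) ≤
          C * ∫⁻ ξ, ENNReal.ofReal (Hm β (𝓕 q : 𝓢(En n, ℂ)) ξ ^ 2) *
            ENNReal.ofReal (Hm β (𝓕 q : 𝓢(En n, ℂ)) (η - ξ) ^ 2) := by
  obtain ⟨C₁, hC₁, hpt⟩ := pt_bound hn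
  obtain ⟨C₂, hC₂, hker⟩ := ker_bound hn hα hαβ hγ
  refine ⟨C₁ ^ 2 * C₂, ENNReal.mul_ne_top (ENNReal.pow_ne_top hC₁) hC₂, fun θ hθ q => ?_⟩
  set f : 𝓢(En n, ℂ) := 𝓕 q with hf
  obtain ⟨hmc, ⟨B, hB⟩, hmi⟩ := hmaj_facts f
  have hB0 : 0 ≤ B := (hmaj_nonneg f 0).trans (hB 0)
  have main : ∀ η : En n, ∃ L : ℂ, ⟪η, θ⟫ < 0 → 
      Tendsto (fun d : ℝ => ∫ r in {r : ℝ | 0 < r ∧ d < |1 - r|},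
              ((1 - r)⁻¹ : ℝ) • Sop θ r ⇑q η) (nhdsWithin 0 (Ioi 0)) (nhds L) ∧
      (1 ≤ kval θ η → ENNReal.ofReal (π * ‖Sop θ 1 ⇑q η‖ + ‖L‖) ≤ C₁ *
        ∫⁻ ξ, kerF (-(kval θ η • θ)) (kval θ η) (fun ξ => hmaj f ξ * hmaj f (η - ξ)) ξ) := by
    intro η
    by_cases h : ⟪η, θ⟫ < 0
    swap
    · exact ⟨0, fun h' => absurd h' h⟩
    obtain ⟨hk, -⟩ := kval_facts hθ h
    obtain ⟨p1, p2, p3⟩ := psi_facts f η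
    obtain ⟨L, hL, hLb⟩ := hpt _ (fun ξ => hmaj f ξ * hmaj f (η - ξ)) (B * B) p1 (by fun_prop) p2 p3
      (fun ξ => mul_le_mul (hB _) (hB _) (hmaj_nonneg _ _) hB0)
      (Integrable.mul_bdd (c := B) hmi (by fun_prop : Continuous _).aestronglyMeasurable
        (Eventually.of_forall fun ξ => by
          rw [Real.norm_eq_abs, abs_of_nonneg (hmaj_nonneg _ _)]; exact hB _))
      (-(kval θ η • θ)) (kval θ η) hk
    refine ⟨L, fun _ => ⟨?_, fun h1 => ?_⟩⟩
    · refine hL.congr' ?_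
      filter_upwards [self_mem_nhdsWithin] with d hd
      have hms : MeasurableSet {r : ℝ | 0 < r ∧ d < |1 - r|} :=
        measurableSet_Ioi.inter (measurableSet_lt measurable_const
          (measurable_const.sub measurable_id).abs)
      refine setIntegral_congr_fun hms fun r hr => ?_
      rw [sop_eq hn hθ h q hr.1]
    · rw [sop_eq hn hθ h q one_pos]
      exact hLb h1
  choose P hP using main
  refine ⟨P, fun η h => (hP η h).1, fun η h hη => ?_⟩
  obtain ⟨hk, hkη⟩ := kval_facts hθ h
  have hk1 : 1 ≤ kval θ η := hη.trans hkη
  have h1 := (hP η h).2 hk1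
  have h2 := hker θ η (kval θ η) f hθ hk1 hkη
  have hj : 0 < jap η := by linarith [one_le_jap η]
  have h3 : ‖(π : ℂ) * Complex.I * Sop θ 1 ⇑q η + P η‖ ≤ π * ‖Sop θ 1 ⇑q η‖ + ‖P η‖ := by
    refine (norm_add_le _ _).trans (le_of_eq ?_)
    rw [norm_mul, norm_mul, Complex.norm_I, Complex.norm_real, Real.norm_eq_abs,
      abs_of_pos Real.pi_pos, mul_one]
  set Z := ∫⁻ ξ, kerF (-(kval θ η • θ)) (kval θ η) (fun ξ => hmaj f ξ * hmaj f (η - ξ)) ξ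
  calc ENNReal.ofReal (jap η ^ (2 * α) * ‖(π : ℂ) * Complex.I * Sop θ 1 ⇑q η + P η‖ ^ 2)
      = (ENNReal.ofReal (jap η ^ α) *
          ENNReal.ofReal ‖(π : ℂ) * Complex.I * Sop θ 1 ⇑q η + P η‖) ^ 2 := by
        rw [← ENNReal.ofReal_mul (by positivity), ← ENNReal.ofReal_pow (by positivity), mul_pow,
          ← Real.rpow_natCast (jap η ^ α), ← Real.rpow_mul hj.le,
          show α * ((2 : ℕ) : ℝ) = 2 * α by push_cast; ring]
    _ ≤ (ENNReal.ofReal (jap η ^ α) * (C₁ * Z)) ^ 2 := by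
        gcongr
        exact (ENNReal.ofReal_le_ofReal h3).trans h1
    _ = C₁ ^ 2 * (ENNReal.ofReal (jap η ^ α) * Z) ^ 2 := by ring
    _ ≤ C₁ ^ 2 * (C₂ * _) := by gcongr
    _ = _ := by rw [mul_assoc]
end op

open scoped LineDeriv in
theorem plancherel_bound {n : ℕ} (u v : 𝓢(En n, ℂ)) (c : ℝ)
    (h : ∀ x, ‖v x‖ ≤ c * (jap x ^ (2:ℝ) * ‖u x‖)) :
    ∫⁻ ξ, ENNReal.ofReal (‖(𝓕 v : 𝓢(En n, ℂ)) ξ‖ ^ 2) ≤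
      ENNReal.ofReal (c ^ 2 * ∫ x, jap x ^ (2 * 2 : ℝ) * ‖u x‖ ^ 2) := by
  have hIntg : ∀ w : 𝓢(En n, ℂ), Integrable (fun x => ‖w x‖ ^ 2) := fun w => by
    simpa using (w.memLp 2).integrable_norm_pow (p := 2) (by norm_num)
  rw [← ofReal_integral_eq_lintegral_ofReal (hIntg _) (ae_of_all _ fun x => by positivity)]
  apply ENNReal.ofReal_le_ofReal
  rw [SchwartzMap.integral_norm_sq_fourier, ← integral_const_mul]
  have hj : ∀ x : En n, 0 ≤ jap x := fun x => Real.sqrt_nonneg _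
  have hp : ∀ x : En n, jap x ^ (2*2:ℝ) * ‖u x‖^2 = (jap x ^ (2:ℝ) * ‖u x‖)^2 := fun x => by
    rw [Real.rpow_mul (hj x), mul_pow]
    norm_cast
  let w : 𝓢(En n, ℂ) := SchwartzMap.smulLeftCLM ℂ (fun x : En n => (1+‖x‖^2)^((2:ℝ)/2)) u
  have hw : ∀ x, ‖w x‖ = jap x ^ (2:ℝ) * ‖u x‖ := fun x => by
    have := SchwartzMap.smulLeftCLM_apply_apply
      (Function.hasTemperateGrowth_one_add_norm_sq_rpow (En n) ((2:ℝ)/2)) u x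
    show ‖w x‖ = _
    rw [this, norm_smul, jap_rpow, Real.norm_of_nonneg (by positivity)]
  refine integral_mono (hIntg v) ?_ fun x => ?_
  · simp only [hp, ← hw]
    exact (hIntg w).const_mul _
  · simp only [hp]
    rw [← mul_pow]
    exact pow_le_pow_left₀ (norm_nonneg _) (h x) 2

/-- Schwartz function `⟨x⟩^β f`. -/
def gS {n : ℕ} (β : ℝ) (f : 𝓢(En n, ℂ)) : 𝓢(En n, ℂ) :=
  SchwartzMap.smulLeftCLM ℂ (fun x : En n => (1+‖x‖^2)^(β/2)) f

theorem gS_apply {n : ℕ} (β : ℝ) (f : 𝓢(En n, ℂ)) (x : En n) : gS β f x = (jap x ^ β : ℝ) • f x := by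
  rw [jap_rpow]
  exact SchwartzMap.smulLeftCLM_apply_apply
      (Function.hasTemperateGrowth_one_add_norm_sq_rpow (En n) (β/2)) f x

theorem sob_eq {n : ℕ} (β : ℝ) (q : 𝓢(En n, ℂ)) :
    sobNorm β 2 ⇑q ^ 2 = ∫ x, jap x ^ (2 * 2 : ℝ) *
      ‖(𝓕⁻ (gS β (𝓕 q)) : 𝓢(En n, ℂ)) x‖ ^ 2 := by
  have h1 : (fun ξ => (jap ξ ^ β : ℝ) • 𝓕 (⇑q) ξ) = ⇑(gS β (𝓕 q)) := by
    funext ξ; rw [gS_apply, SchwartzMap.fourier_coe]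
  unfold sobNorm
  rw [h1, ← SchwartzMap.fourierInv_coe, ← Real.rpow_natCast, ← Real.rpow_mul]
  · norm_num
  · exact integral_nonneg fun x => mul_nonneg (Real.rpow_nonneg (Real.sqrt_nonneg _) _) (sq_nonneg _)

theorem jap_deriv {n : ℕ} (β : ℝ) (hβ : 0 ≤ β) (x : En n) :
    ∃ L : En n →L[ℝ] ℝ, HasFDerivAt (fun x : En n => jap x ^ β) L x ∧ ‖L‖ ≤ β * jap x ^ β := by
  have h1 : HasFDerivAt (fun x : En n => 1 + ‖x‖^2) ((2:ℝ) • (innerSL ℝ x)) x :=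
    by
    have h := (hasStrictFDerivAt_norm_sq x).hasFDerivAt.const_add 1
    rw [← Nat.cast_smul_eq_nsmul ℝ] at h
    exact_mod_cast h
  have h2 := h1.rpow_const (p := β/2) (Or.inl (by positivity))
  refine ⟨_, h2.congr_of_eventuallyEq (Eventually.of_forall fun y => jap_rpow y β), ?_⟩
  rw [norm_smul, norm_smul, innerSL_apply_norm, Real.norm_of_nonneg (by positivity), Real.norm_two,
    jap_rpow]
  have h3 : ‖x‖ ≤ 1 + ‖x‖^2 := by nlinarith [sq_nonneg (‖x‖ - 1)]
  have h4 : (1+‖x‖^2)^(β/2) = (1+‖x‖^2)^(β/2-1) * (1+‖x‖^2) := by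
    rw [← Real.rpow_add_one (by positivity)]; congr 1; ring
  rw [h4]
  have : 0 ≤ β * (1+‖x‖^2)^(β/2-1) := by positivity
  nlinarith [mul_le_mul_of_nonneg_left h3 this]

theorem norm_clm_le_sum {n : ℕ} (L : En n →L[ℝ] ℂ) :
    ‖L‖ ≤ ∑ j, ‖L (EuclideanSpace.single j 1)‖ := by
  refine L.opNorm_le_bound (Finset.sum_nonneg fun _ _ => norm_nonneg _) fun x => ?_
  have hx : x = ∑ j, x j • (EuclideanSpace.single j (1:ℝ) : En n) := by
    have := (EuclideanSpace.basisFun (Fin n) ℝ).sum_repr x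
    simpa using this.symm
  conv_lhs => rw [hx]
  rw [map_sum, Finset.sum_mul]
  refine (norm_sum_le _ _).trans (Finset.sum_le_sum fun j _ => ?_)
  rw [map_smul, norm_smul, mul_comm]
  exact mul_le_mul_of_nonneg_left (PiLp.norm_apply_le x j) (norm_nonneg _)

theorem Hm_le {n : ℕ} (β : ℝ) (hβ : 0 ≤ β) (f : 𝓢(En n, ℂ)) (x : En n) :
    Hm β f x ≤ (1+β) * ‖gS β f x‖ +
      ∑ j, ‖fderiv ℝ (gS β f) x (EuclideanSpace.single j 1)‖ := by
  obtain ⟨L, hL, hLn⟩ := jap_deriv β hβ x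
  have hj : 0 ≤ jap x ^ β := Real.rpow_nonneg (Real.sqrt_nonneg _) _
  have hf := (f.differentiableAt (x := x)).hasFDerivAt
  have hg : HasFDerivAt (gS β f) _ x :=
    (hL.smul hf).congr_of_eventuallyEq (Eventually.of_forall fun y => gS_apply β f y)
  have h1 : jap x ^ β • fderiv ℝ f x = fderiv ℝ (gS β f) x - L.smulRight (f x) := by
    rw [hg.fderiv]; ext; simp
  have h2 : jap x ^ β * ‖fderiv ℝ f x‖ ≤ ‖fderiv ℝ (gS β f) x‖ + β * jap x ^ β * ‖f x‖ := by
    calc jap x ^ β * ‖fderiv ℝ f x‖ = ‖jap x ^ β • fderiv ℝ f x‖ := by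
          rw [norm_smul, Real.norm_of_nonneg hj]
      _ ≤ ‖fderiv ℝ (gS β f) x‖ + ‖L.smulRight (f x)‖ := by rw [h1]; exact norm_sub_le _ _
      _ ≤ _ := by
        rw [ContinuousLinearMap.norm_smulRight_apply]
        gcongr
  have h3 := norm_clm_le_sum (fderiv ℝ (gS β f) x)
  have h4 : ‖gS β f x‖ = jap x ^ β * ‖f x‖ := by
    rw [gS_apply, norm_smul, Real.norm_of_nonneg hj]
  rw [h4]
  unfold Hm hmaj
  nlinarith

open scoped LineDeriv in
theorem Hm_lint {n : ℕ} (β : ℝ) (hβ : 0 ≤ β) : ∃ C : ℝ, 0 ≤ C ∧ ∀ q : 𝓢(En n, ℂ),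
    ∫⁻ ξ, ENNReal.ofReal (Hm β (𝓕 q : 𝓢(En n, ℂ)) ξ ^ 2) ≤
      ENNReal.ofReal (C * sobNorm β 2 ⇑q ^ 2) := by
  refine ⟨2 * (1+β)^2 + 2 * n * (n * (2*π)^2), by positivity, fun q => ?_⟩
  set g := gS β (𝓕 q) with hg
  set u : 𝓢(En n, ℂ) := 𝓕⁻ g with hu
  have hgu : g = 𝓕 u := (FourierTransform.fourier_fourierInv_eq g).symm
  rw [sob_eq, ← hg, ← hu]
  set I := ∫ x, jap x ^ (2 * 2 : ℝ) * ‖u x‖ ^ 2 with hI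
  have hI0 : 0 ≤ I :=
    integral_nonneg fun x => mul_nonneg (Real.rpow_nonneg (Real.sqrt_nonneg _) _) (sq_nonneg _)
  have hj1 : ∀ x : En n, 1 ≤ jap x := one_le_jap
  have hA : ∫⁻ ξ, ENNReal.ofReal (‖g ξ‖ ^ 2) ≤ ENNReal.ofReal I := by
    have := plancherel_bound u u 1 (fun x => by
      rw [one_mul]
      exact le_mul_of_one_le_left (norm_nonneg _) (Real.one_le_rpow (hj1 x) (by norm_num)))
    rwa [← hgu, one_pow, one_mul] at this
  have hB : ∀ j : Fin n, ∫⁻ ξ, ENNReal.ofReal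
      (‖fderiv ℝ g ξ (EuclideanSpace.single j 1)‖ ^ 2) ≤ ENNReal.ofReal ((2*π)^2 * I) := by
    intro j
    set m : En n := EuclideanSpace.single j 1 with hm
    have htg : Function.HasTemperateGrowth (fun x : En n => inner ℝ x m) := by fun_prop
    have := plancherel_bound u (-(2 * π * Complex.I) • SchwartzMap.smulLeftCLM ℂ (inner ℝ · m) u)
      (2*π) (fun x => by
      rw [_root_.smul_apply, SchwartzMap.smulLeftCLM_apply_apply htg, norm_smul, norm_smul]
      have e1 : ‖(-(2 * π * Complex.I) : ℂ)‖ = 2 * π := by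
        simp [abs_of_pos Real.pi_pos]
      rw [e1]
      refine mul_le_mul_of_nonneg_left (mul_le_mul_of_nonneg_right ?_ (norm_nonneg _)) (by positivity)
      have e2 : ‖(inner ℝ x m : ℝ)‖ ≤ ‖x‖ := by
        have := norm_inner_le_norm (𝕜 := ℝ) x m
        simpa [hm] using this
      have e3 := norm_le_jap x
      have e4 := hj1 x
      have e5 : jap x ^ (2:ℝ) = jap x * jap x := by norm_cast; ring
      rw [e5]; nlinarith)
    rw [← SchwartzMap.lineDerivOp_fourier_eq, ← hgu] at this
    exact this
  have hmg : Measurable fun ξ => ENNReal.ofReal (‖g ξ‖ ^ 2) :=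
    (g.continuous.norm.pow 2).measurable.ennreal_ofReal
  have hmd : ∀ j : Fin n, Measurable fun ξ => ENNReal.ofReal
      (‖fderiv ℝ g ξ (EuclideanSpace.single j 1)‖ ^ 2) := fun j =>
    ((((∂_{(EuclideanSpace.single j 1 : En n)} g : 𝓢(En n, ℂ)).continuous).norm).pow 2).measurable.ennreal_ofReal
  have hpt : ∀ ξ, ENNReal.ofReal (Hm β (𝓕 q : 𝓢(En n, ℂ)) ξ ^ 2) ≤
      ENNReal.ofReal (2 * (1+β)^2) * ENNReal.ofReal (‖g ξ‖ ^ 2) + ENNReal.ofReal (2 * n) *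
        ∑ j, ENNReal.ofReal (‖fderiv ℝ g ξ (EuclideanSpace.single j 1)‖ ^ 2) := by
    intro ξ
    rw [← ENNReal.ofReal_sum_of_nonneg (fun _ _ => by positivity), ← ENNReal.ofReal_mul (by positivity),
      ← ENNReal.ofReal_mul (by positivity), ← ENNReal.ofReal_add (by positivity)
        (mul_nonneg (by positivity) (Finset.sum_nonneg fun _ _ => by positivity))]
    apply ENNReal.ofReal_le_ofReal
    have h1 := pow_le_pow_left₀ (Hm_nonneg β _ ξ) (Hm_le β hβ (𝓕 q) ξ) 2
    rw [← hg] at h1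
    refine h1.trans ?_
    have h2 := sq_sum_le_card_mul_sum_sq (s := Finset.univ)
      (f := fun j : Fin n => ‖fderiv ℝ g ξ (EuclideanSpace.single j 1)‖)
    rw [Finset.card_univ, Fintype.card_fin] at h2
    refine (add_sq_le).trans ?_
    rw [mul_pow]
    nlinarith
  refine (lintegral_mono hpt).trans ?_
  rw [lintegral_add_left (hmg.const_mul _), lintegral_const_mul _ hmg,
    lintegral_const_mul _ (Finset.measurable_fun_sum _ fun j _ => hmd j),
    lintegral_finsetSum _ fun j _ => hmd j]
  calc _ ≤ ENNReal.ofReal (2 * (1+β)^2) * ENNReal.ofReal I + ENNReal.ofReal (2 * n) *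
        ∑ j : Fin n, ENNReal.ofReal ((2*π)^2 * I) := by
        gcongr with j _
        exact hB j
    _ = _ := by
      rw [← ENNReal.ofReal_sum_of_nonneg (fun _ _ => by positivity), ← ENNReal.ofReal_mul (by positivity),
        ← ENNReal.ofReal_mul (by positivity), ← ENNReal.ofReal_add (by positivity)
        (mul_nonneg (by positivity) (Finset.sum_nonneg fun _ _ => by positivity))]
      congr 1
      rw [Finset.sum_const, Finset.card_univ, Fintype.card_fin, nsmul_eq_mul]
      ring

/-- Estimate of the (cut-off) double dispersion operator of fixed angle scattering
(Theorem 1.3, positive part): with `B_{θ,2}(q) = iπ S_{θ,1}(q) + P_θ(q)` on `H_θ`,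
the function `F = χ ⬝ (B_{θ,2}(q) + B_{-θ,2}(q))`, i.e. the Fourier transform of
`Q̃_{θ,2}(q)`, satisfies `‖F‖_{L²_α} ≤ C ‖q‖²_{W^{β,2}_2}`; in particular all the
principal value limits defining `P_{±θ}(q)` exist. -/
theorem double_dispersion_estimate (n : ℕ) (hn : 2 ≤ n) (β C₀ α : ℝ)
    (hβ : 0 ≤ β) (hC₀ : 1 < C₀) (χ : En n → ℝ) (hχ : IsCutoff C₀ χ)
    (hα : (((n : ℝ) - 3) / 2 < β ∧ β < ((n : ℝ) - 1) / 2 ∧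
            α < 2 * β - ((n : ℝ) - 3) / 2) ∨
          (((n : ℝ) - 1) / 2 ≤ β ∧ α < β + 1)) :
    ∃ C : ℝ, 0 < C ∧ ∀ θ : En n, ‖θ‖ = 1 → ∀ q : 𝓢(En n, ℂ),
      ∃ P₁ P₂ : En n → ℂ,
        (∀ η : En n, ⟪η, θ⟫ < 0 →
          Filter.Tendsto
            (fun d : ℝ => ∫ r in {r : ℝ | 0 < r ∧ d < |1 - r|},
              ((1 - r)⁻¹ : ℝ) • Sop θ r ⇑q η)
            (nhdsWithin 0 (Set.Ioi 0)) (nhds (P₁ η))) ∧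
        (∀ η : En n, ⟪η, -θ⟫ < 0 →
          Filter.Tendsto
            (fun d : ℝ => ∫ r in {r : ℝ | 0 < r ∧ d < |1 - r|},
              ((1 - r)⁻¹ : ℝ) • Sop (-θ) r ⇑q η)
            (nhdsWithin 0 (Set.Ioi 0)) (nhds (P₂ η))) ∧
        L2w α (fun η => (χ η : ℝ) •
            ((if ⟪η, θ⟫ < 0 then (Real.pi : ℂ) * Complex.I * Sop θ 1 ⇑q η + P₁ η else 0) +
             (if ⟪η, -θ⟫ < 0 then (Real.pi : ℂ) * Complex.I * Sop (-θ) 1 ⇑q η + P₂ η else 0)))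
          ≤ C * sobNorm β 2 ⇑q ^ 2 := by
  obtain ⟨C1, hC1, H1⟩ := op_bound (n := n) hn (α := max α 0) (β := β) (le_max_right _ _)
    (by
      have hn2 : (2:ℝ) ≤ n := by exact_mod_cast hn
      rcases hα with ⟨h1, h2, h3⟩ | ⟨h1, h2⟩
      · exact max_le (by linarith) (by linarith)
      · exact max_le (by linarith) (by linarith))
    (by
      have hn2 : (2:ℝ) ≤ n := by exact_mod_cast hn
      rcases hα with ⟨h1, h2, h3⟩ | ⟨h1, h2⟩ <;> rcases max_cases α 0 with ⟨h, _⟩ | ⟨h, _⟩ <;>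
        rw [h] <;> linarith)
  obtain ⟨C2, hC2, H2⟩ := Hm_lint (n := n) β hβ
  refine ⟨(C1.toReal * C2 ^ 2) ^ (1/2:ℝ) + 1, by positivity, fun θ hθ q => ?_⟩
  obtain ⟨P₁, hP1, hB1⟩ := H1 θ hθ q
  obtain ⟨P₂, hP2, hB2⟩ := H1 (-θ) (by rwa [norm_neg]) q
  refine ⟨P₁, P₂, hP1, hP2, ?_⟩
  set F : En n → ℂ := fun η => (χ η : ℝ) •
            ((if ⟪η, θ⟫ < 0 then (Real.pi : ℂ) * Complex.I * Sop θ 1 ⇑q η + P₁ η else 0) +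
             (if ⟪η, -θ⟫ < 0 then (Real.pi : ℂ) * Complex.I * Sop (-θ) 1 ⇑q η + P₂ η else 0))
    with hF
  set h : En n → ℝ≥0∞ := fun ξ => ENNReal.ofReal (Hm β (𝓕 q : 𝓢(En n, ℂ)) ξ ^ 2) with hh
  have hhm : Measurable h := ((Hm_cont β _).pow 2).measurable.ennreal_ofReal
  have hj0 : ∀ η : En n, 0 ≤ jap η := fun η => Real.sqrt_nonneg _
  have hpt : ∀ η, ENNReal.ofReal (jap η ^ (2 * α) * ‖F η‖ ^ 2) ≤
      C1 * ∫⁻ ξ, h ξ * h (η - ξ) := by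
    intro η
    by_cases hη : ‖η‖ < C₀
    · have : F η = 0 := by simp only [hF, hχ.eq_zero η hη, zero_smul]
      simp [this]
    have hη1 : 1 ≤ ‖η‖ := by linarith
    have hw : jap η ^ (2 * α) ≤ jap η ^ (2 * max α 0) :=
      Real.rpow_le_rpow_of_exponent_le (one_le_jap η) (by linarith [le_max_left α 0])
    have hχ1 : ‖χ η‖ ≤ 1 := by
      obtain ⟨a, b⟩ := hχ.mem_Icc η
      rwa [Real.norm_of_nonneg a]
    have key : ∀ z : ℂ, F η = (χ η : ℝ) • z →
        ENNReal.ofReal (jap η ^ (2 * α) * ‖F η‖ ^ 2) ≤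
          ENNReal.ofReal (jap η ^ (2 * max α 0) * ‖z‖ ^ 2) := by
      intro z hz
      apply ENNReal.ofReal_le_ofReal
      have h1 : ‖F η‖ ≤ ‖z‖ := by
        rw [hz, norm_smul]
        exact mul_le_of_le_one_left (norm_nonneg _) hχ1
      exact mul_le_mul hw (pow_le_pow_left₀ (norm_nonneg _) h1 2) (by positivity)
        (Real.rpow_nonneg (hj0 η) _)
    by_cases h1 : ⟪η, θ⟫ < 0
    · have h2 : ¬ ⟪η, -θ⟫ < 0 := by rw [inner_neg_right]; linarith
      refine (key _ ?_).trans (hB1 η h1 hη1)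
      simp only [hF, if_pos h1, if_neg h2, add_zero]
    · by_cases h2 : ⟪η, -θ⟫ < 0
      · refine (key _ ?_).trans (hB2 η h2 hη1)
        simp only [hF, if_neg h1, if_pos h2, zero_add]
      · have : F η = 0 := by simp only [hF, if_neg h1, if_neg h2, add_zero, smul_zero]
        simp [this]
  have hT : ∫⁻ η, ∫⁻ ξ, h ξ * h (η - ξ) = (∫⁻ ξ, h ξ) ^ 2 := by
    rw [lintegral_lintegral_swap
      (((hhm.comp measurable_snd).mul (hhm.comp (measurable_fst.sub measurable_snd))).aemeasurable)]
    have : ∀ ξ : En n, ∫⁻ η, h ξ * h (η - ξ) = h ξ * ∫⁻ η, h η := fun ξ => by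
      rw [lintegral_const_mul (h ξ) (f := fun η => h (η - ξ)) (hhm.comp (measurable_id.sub_const ξ)),
        lintegral_sub_right_eq_self h ξ]
    simp only [this]
    rw [lintegral_mul_const _ hhm, sq]
  set N := sobNorm β 2 ⇑q ^ 2 with hN
  have hN0 : 0 ≤ N := sq_nonneg _
  have hfin : ENNReal.ofReal (∫ η, jap η ^ (2 * α) * ‖F η‖ ^ 2) ≤
      ENNReal.ofReal (C1.toReal * C2 ^ 2 * N ^ 2) := by
    calc ENNReal.ofReal (∫ η, jap η ^ (2 * α) * ‖F η‖ ^ 2)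
        ≤ ∫⁻ η, ENNReal.ofReal (jap η ^ (2 * α) * ‖F η‖ ^ 2) :=
          ofReal_integral_le fun η => mul_nonneg (Real.rpow_nonneg (hj0 η) _) (sq_nonneg _)
      _ ≤ ∫⁻ η, C1 * ∫⁻ ξ, h ξ * h (η - ξ) := lintegral_mono hpt
      _ = C1 * (∫⁻ ξ, h ξ) ^ 2 := by rw [lintegral_const_mul' _ _ hC1, hT]
      _ ≤ C1 * (ENNReal.ofReal (C2 * N)) ^ 2 := by gcongr; exact H2 q
      _ = _ := by
        rw [← ENNReal.ofReal_pow (by positivity)]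
        nth_rewrite 1 [← ENNReal.ofReal_toReal hC1]
        rw [← ENNReal.ofReal_mul ENNReal.toReal_nonneg]
        congr 1; ring
  have hfin2 : ∫ η, jap η ^ (2 * α) * ‖F η‖ ^ 2 ≤ C1.toReal * C2 ^ 2 * N ^ 2 :=
    (ENNReal.ofReal_le_ofReal_iff (by positivity)).1 hfin
  unfold L2w
  calc (∫ η, jap η ^ (2 * α) * ‖F η‖ ^ 2) ^ (1/2 : ℝ)
      ≤ (C1.toReal * C2 ^ 2 * N ^ 2) ^ (1/2 : ℝ) :=
        Real.rpow_le_rpow (integral_nonneg fun η => mul_nonneg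
          (Real.rpow_nonneg (hj0 η) _) (sq_nonneg _)) hfin2 (by norm_num)
    _ = (C1.toReal * C2 ^ 2) ^ (1/2:ℝ) * N := by
        rw [Real.mul_rpow (by positivity) (by positivity), ← Real.sqrt_eq_rpow (N ^ 2),
          Real.sqrt_sq hN0]
    _ ≤ _ := mul_le_mul_of_nonneg_right (by linarith) hN0

end
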